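/- If H is a subgraph of a smallest counterexample and H contains at least two distinct cycles, then H has at least 10 vertices. In particular, any two 5-cycles in a smallest counterexample are vertex-disjoint. -/

import Mathlib

open SimpleGraph

/-- The degree of a vertex, as the cardinality of its neighbor set. -/
noncomputable def deg {V : Type} (G : SimpleGraph V) (v : V) : ℕ :=
  (G.neighborSet v).ncard

/-- The potential of a finite graph: `5 n(G) - 4 e(G)`. -/
noncomputable def pot {V : Type} [Fintype V] (G : SimpleGraph V) : ℤ :=
  5 * (Fintype.card V : ℤ) - 4 * (G.edgeSet.ncard : ℤ)

/-- A graph is 5/2-critical if it has no homomorphism to the 5-cycle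
but every proper subgraph has one. -/
def Critical52 {V : Type} (G : SimpleGraph V) : Prop :=
  IsEmpty (G →g cycleGraph 5) ∧
  ∀ H : G.Subgraph, H ≠ ⊤ → Nonempty (H.coe →g cycleGraph 5)

/-- The exceptional graph `E₁`: a 9-cycle `0 1 2 3 4 5 6 7 8` together
with a vertex `9` adjacent to `0`, `3` and `6`. -/
def E1 : SimpleGraph (Fin 10) := SimpleGraph.fromEdgeSet
  {s(0,1), s(1,2), s(2,3), s(3,4), s(4,5), s(5,6), s(6,7), s(7,8), s(8,0),
   s(9,0), s(9,3), s(9,6)}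

/-- The exceptional graph `E₂`: two 5-cycles `0 1 2 3 4` and `0 1 5 6 7`
sharing exactly the edge `01`, together with a path `3 8 9 6`. -/
def E2 : SimpleGraph (Fin 10) := SimpleGraph.fromEdgeSet
  {s(0,1), s(1,2), s(2,3), s(3,4), s(4,0),
   s(1,5), s(5,6), s(6,7), s(7,0),
   s(3,8), s(8,9), s(9,6)}

/-- A smallest counterexample: a 5/2-critical graph, not isomorphic to `C₃`, `E₁`, `E₂`,
with potential at least 2, such that every smaller 5/2-critical graph not isomorphic
to `C₃`, `E₁`, `E₂` has potential at most 1. -/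
def SmallestCex {V : Type} [Fintype V] (G : SimpleGraph V) : Prop :=
  Critical52 G ∧ IsEmpty (G ≃g cycleGraph 3) ∧ IsEmpty (G ≃g E1) ∧ IsEmpty (G ≃g E2) ∧
  2 ≤ pot G ∧
  ∀ (m : ℕ) (H : SimpleGraph (Fin m)), Critical52 H →
    IsEmpty (H ≃g cycleGraph 3) → IsEmpty (H ≃g E1) → IsEmpty (H ≃g E2) →
    m < Fintype.card V → pot H ≤ 1

/-- A string: a path of positive length whose endvertices have degree at least 3
and whose internal vertices have degree 2. A `k`-string is a string of length `k+1`. -/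
def IsString {V : Type} (G : SimpleGraph V) {u v : V} (p : G.Walk u v) : Prop :=
  p.IsPath ∧ 0 < p.length ∧ 3 ≤ deg G u ∧ 3 ≤ deg G v ∧
  ∀ w ∈ p.support, w ≠ u → w ≠ v → deg G w = 2

/-- `v` lies on a 5-cycle of `G`. -/
def InFiveCycle {V : Type} (G : SimpleGraph V) (v : V) : Prop :=
  ∃ (w : V) (c : G.Walk w w), c.IsCycle ∧ c.length = 5 ∧ v ∈ c.support

/-- `v` is a `(k₁,k₂,k₃)`-vertex: it has degree 3 and is the end of a `k₁`-string,
a `k₂`-string and a `k₃`-string leaving `v` through its three distinct edges. -/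
def IsVertex3 {V : Type} (G : SimpleGraph V) (v : V) (k1 k2 k3 : ℕ) : Prop :=
  deg G v = 3 ∧ ∃ (u1 u2 u3 : V) (p1 : G.Walk v u1) (p2 : G.Walk v u2) (p3 : G.Walk v u3),
    IsString G p1 ∧ IsString G p2 ∧ IsString G p3 ∧
    p1.getVert 1 ≠ p2.getVert 1 ∧ p1.getVert 1 ≠ p3.getVert 1 ∧ p2.getVert 1 ≠ p3.getVert 1 ∧
    p1.length = k1 + 1 ∧ p2.length = k2 + 1 ∧ p3.length = k3 + 1

/-- `v` is a `(k₁,k₂,k₃,k₄)`-vertex: it has degree 4 and is the end of strings of the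
corresponding lengths leaving `v` through its four distinct edges. -/
def IsVertex4 {V : Type} (G : SimpleGraph V) (v : V) (k1 k2 k3 k4 : ℕ) : Prop :=
  deg G v = 4 ∧ ∃ (u1 u2 u3 u4 : V) (p1 : G.Walk v u1) (p2 : G.Walk v u2)
    (p3 : G.Walk v u3) (p4 : G.Walk v u4),
    IsString G p1 ∧ IsString G p2 ∧ IsString G p3 ∧ IsString G p4 ∧
    p1.getVert 1 ≠ p2.getVert 1 ∧ p1.getVert 1 ≠ p3.getVert 1 ∧ p1.getVert 1 ≠ p4.getVert 1 ∧
    p2.getVert 1 ≠ p3.getVert 1 ∧ p2.getVert 1 ≠ p4.getVert 1 ∧ p3.getVert 1 ≠ p4.getVert 1 ∧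
    p1.length = k1 + 1 ∧ p2.length = k2 + 1 ∧ p3.length = k3 + 1 ∧ p4.length = k4 + 1

/-- `H` contains at least two distinct cycles, where cycles are counted as subgraphs,
i.e. two cycles are distinct if their edge sets differ. -/
def TwoDistinctCycles {V : Type} (H : SimpleGraph V) : Prop :=
  ∃ (v1 v2 : V) (c1 : H.Walk v1 v1) (c2 : H.Walk v2 v2),
    c1.IsCycle ∧ c2.IsCycle ∧ {e | e ∈ c1.edges} ≠ {e | e ∈ c2.edges}

/-- The degree of a 5-cycle (cell) `c` in `G`: the number of strings not contained in `c`
that intersect `c`, strings being counted by their edge sets. -/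
noncomputable def cellDegree {V : Type} (G : SimpleGraph V) {w : V} (c : G.Walk w w) : ℕ :=
  {S : Set (Sym2 V) | ∃ (u v : V) (p : G.Walk u v), IsString G p ∧ S = {e | e ∈ p.edges} ∧
    ¬ S ⊆ {e | e ∈ c.edges} ∧ ∃ x ∈ p.support, x ∈ c.support}.ncard

/-- Adjacency in the 5-cycle, in arithmetic form. -/
def A5 (x y : Fin 5) : Prop := x = y + 1 ∨ y = x + 1

instance (x y : Fin 5) : Decidable (A5 x y) := by unfold A5; infer_instance

lemma A5_iff (x y : Fin 5) : (cycleGraph 5).Adj x y ↔ A5 x y := by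
  revert x y; decide

lemma A5_symm {x y : Fin 5} (h : A5 x y) : A5 y x := by
  unfold A5 at *; tauto

/-- `f` is a homomorphism to the 5-cycle. -/
def IsCol {W : Type} (K : SimpleGraph W) (f : W → Fin 5) : Prop :=
  ∀ a b, K.Adj a b → A5 (f a) (f b)

open Classical in
/-- Number of ordered adjacent pairs. -/
noncomputable def dart {W : Type} [Fintype W] (K : SimpleGraph W) : ℕ :=
  (Finset.univ.filter (fun p : W × W => K.Adj p.1 p.2)).card

lemma dart_eq {W : Type} [Fintype W] (K : SimpleGraph W) : dart K = 2 * K.edgeSet.ncard := by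
  classical
  have h1 := K.sum_degrees_eq_twice_card_edges
  have h2 : K.edgeSet.ncard = K.edgeFinset.card := by
    rw [← coe_edgeFinset, Set.ncard_coe_finset]
  rw [h2, ← h1, dart]
  rw [Finset.card_filter, ← Finset.univ_product_univ, Finset.sum_product]
  refine Finset.sum_congr rfl fun v _ => ?_
  rw [← Finset.card_filter, ← card_neighborFinset_eq_degree]
  congr 1
  ext; simp

/-- `K` is a copy of `E` (with additional isolated vertices allowed), via `σ`. -/
def IsCopy {W : Type} {n : ℕ} (K : SimpleGraph W) (E : SimpleGraph (Fin n)) (σ : Fin n → W) : Prop :=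
  Function.Injective σ ∧ ∀ x y, K.Adj x y ↔ ∃ a b, E.Adj a b ∧ σ a = x ∧ σ b = y

lemma exists_small {V : Type} [Fintype V] {G : SimpleGraph V} (hG : SmallestCex G)
    {W : Type} [Fintype W] (K : SimpleGraph W) (hK : ¬ ∃ f, IsCol K f)
    (hcard : K.support.ncard < Fintype.card V) :
    ∃ K1 ≤ K, (¬ ∃ f, IsCol K1 f) ∧
      ((∃ σ, IsCopy K1 (cycleGraph 3) σ) ∨ (∃ σ, IsCopy K1 E1 σ) ∨
       (∃ σ, IsCopy K1 E2 σ) ∨ 5 * K1.support.ncard ≤ 2 * dart K1 + 1) := by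
  classical
  obtain ⟨K1, hK1⟩ := (Set.toFinite {K1 : SimpleGraph W | K1 ≤ K ∧ ¬ ∃ f, IsCol K1 f}).exists_minimal
    ⟨K, le_rfl, hK⟩
  obtain ⟨⟨hle, hnc⟩, hmin⟩ := hK1
  refine ⟨K1, hle, hnc, ?_⟩
  set m := K1.support.ncard with hm
  have hm' : m < Fintype.card V := by
    refine lt_of_le_of_lt ?_ hcard
    exact Set.ncard_le_ncard (support_mono hle) (Set.toFinite _)
  have e : Fin m ≃ K1.support := by
    refine (Fintype.equivFinOfCardEq ?_).symm
    rw [hm, Set.ncard_eq_toFinset_card', Set.toFinset_card]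
  let Hm : SimpleGraph (Fin m) := K1.comap (fun a => (e a : W))
  have hadj : ∀ a b, Hm.Adj a b ↔ K1.Adj (e a) (e b) := fun a b => Iff.rfl
  have hinj : ∀ a b, (e a : W) = e b → a = b := fun a b h => e.injective (Subtype.ext h)
  have hcrit : Critical52 Hm := by
    constructor
    · constructor
      intro g
      apply hnc
      refine ⟨fun w => if h : w ∈ K1.support then g (e.symm ⟨w, h⟩) else 0, ?_⟩
      intro a b hab
      have ha : a ∈ K1.support := ⟨b, hab⟩
      have hb : b ∈ K1.support := ⟨a, hab.symm⟩
      simp only [ha, hb, dif_pos]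
      rw [← A5_iff]
      apply g.map_rel
      rw [hadj]; simpa using hab
    · intro Hs hne
      let K2 : SimpleGraph W :=
        { Adj := fun x y => ∃ a b, Hs.Adj a b ∧ (e a : W) = x ∧ (e b : W) = y
          symm := ⟨by rintro x y ⟨a, b, h, rfl, rfl⟩; exact ⟨b, a, h.symm, rfl, rfl⟩⟩
          loopless := ⟨by
            rintro x ⟨a, b, h, h1, h2⟩
            have := hinj a b (h1.trans h2.symm)
            subst this
            exact Hm.loopless.irrefl _ (Hs.adj_sub h)⟩ }
      have hK2 : K2 ≤ K1 := by
        rintro x y ⟨a, b, h, rfl, rfl⟩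
        exact Hs.adj_sub h
      have hcol : ∃ f, IsCol K2 f := by
        by_contra hcon
        have h3 : K1 ≤ K2 := hmin ⟨hK2.trans hle, hcon⟩ hK2
        apply hne
        have hA : ∀ a b, Hm.Adj a b → Hs.Adj a b := by
          intro a b hab
          obtain ⟨a', b', h, h1, h2⟩ := h3 hab
          rw [← hinj _ _ h1, ← hinj _ _ h2]; exact h
        apply Subgraph.ext
        · ext a
          simp only [Subgraph.verts_top, Set.mem_univ, iff_true]
          obtain ⟨w, hw⟩ := (e a).2
          have hw' : w ∈ K1.support := ⟨_, hw.symm⟩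
          have : Hm.Adj a (e.symm ⟨w, hw'⟩) := by rw [hadj]; simpa using hw
          exact Hs.edge_vert (hA _ _ this)
        · ext a b
          simp only [Subgraph.top_adj]
          exact ⟨fun h => Hs.adj_sub h, hA a b⟩
      obtain ⟨f, hf⟩ := hcol
      exact ⟨⟨fun a => f (e a), fun {a b} hab => (A5_iff _ _).2 (hf _ _ ⟨a, b, hab, rfl, rfl⟩)⟩⟩
  have hmap : ∀ (n : ℕ) (E : SimpleGraph (Fin n)), Nonempty (Hm ≃g E) →
      ∃ σ, IsCopy K1 E σ := by
    rintro n E ⟨i⟩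
    have hj : Function.Injective (fun z => (e (i.symm z) : W)) := by
      intro a b h
      have h' : i.symm a = i.symm b := hinj _ _ h
      simpa using congrArg i h'
    refine ⟨fun z => (e (i.symm z) : W), hj, ?_⟩
    intro x y
    constructor
    · intro h
      have hx : x ∈ K1.support := ⟨y, h⟩
      have hy : y ∈ K1.support := ⟨x, h.symm⟩
      refine ⟨i (e.symm ⟨x, hx⟩), i (e.symm ⟨y, hy⟩), ?_, by simp, by simp⟩
      rw [i.map_adj_iff, hadj]; simpa using h
    · rintro ⟨a, b, h, rfl, rfl⟩
      rw [← hadj, i.symm.map_adj_iff]; exact h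
  by_cases h1 : Nonempty (Hm ≃g cycleGraph 3)
  · exact Or.inl (hmap _ _ h1)
  by_cases h2 : Nonempty (Hm ≃g E1)
  · exact Or.inr (Or.inl (hmap _ _ h2))
  by_cases h3 : Nonempty (Hm ≃g E2)
  · exact Or.inr (Or.inr (Or.inl (hmap _ _ h3)))
  refine Or.inr (Or.inr (Or.inr ?_))
  have := hG.2.2.2.2.2 m Hm hcrit (not_nonempty_iff.1 h1) (not_nonempty_iff.1 h2)
    (not_nonempty_iff.1 h3) hm'
  have hd : dart K1 = dart Hm := by
    unfold dart
    symm
    refine Finset.card_bij (fun p _ => ((e p.1 : W), (e p.2 : W))) ?_ ?_ ?_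
    · rintro ⟨a, b⟩ h; simpa [hadj] using h
    · rintro ⟨a, b⟩ _ ⟨c, d⟩ _ h
      simp only [Prod.mk.injEq] at h
      rw [hinj _ _ h.1, hinj _ _ h.2]
    · rintro ⟨x, y⟩ h
      simp only [Finset.mem_filter, Finset.mem_univ, true_and] at h
      refine ⟨(e.symm ⟨x, ⟨y, h⟩⟩, e.symm ⟨y, ⟨x, h.symm⟩⟩), ?_, by simp⟩
      simpa [hadj] using h
  have h4 := dart_eq Hm
  unfold pot at this
  simp only [Fintype.card_fin] at this
  omega

/-- `f` colours the induced subgraph on `S`. -/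
def ColOn {V : Type} (G : SimpleGraph V) (S : Finset V) (f : V → Fin 5) : Prop :=
  ∀ a ∈ S, ∀ b ∈ S, G.Adj a b → A5 (f a) (f b)

lemma exists_colOn {V : Type} [Fintype V] {G : SimpleGraph V} (hG : Critical52 G)
    (S : Finset V) (hS : S ≠ Finset.univ) : ∃ f, ColOn G S f := by
  classical
  obtain ⟨g⟩ := hG.2 ((⊤ : G.Subgraph).induce (S : Set V)) (by
    intro h
    apply hS
    have := congrArg Subgraph.verts h
    simp at this
    exact this)
  refine ⟨fun v => if h : v ∈ S then g ⟨v, by simpa using h⟩ else 0, ?_⟩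
  intro a ha b hb hab
  simp only [ha, hb, dif_pos]
  rw [← A5_iff]
  apply g.map_rel
  simp [ha, hb, hab]

lemma not_col {V : Type} {G : SimpleGraph V} (hG : Critical52 G) (f : V → Fin 5)
    (hf : IsCol G f) : False :=
  hG.1.false ⟨f, fun {a b} h => (A5_iff _ _).2 (hf a b h)⟩

/-- Boolean adjacency from a list of edges. -/
def ladj (L : List (ℕ × ℕ)) (a b : ℕ) : Bool := L.any fun p => (Nat.beq p.1 a && Nat.beq p.2 b) || (Nat.beq p.1 b && Nat.beq p.2 a)

/-- The edges of `E1`. -/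
def L1 : List (ℕ × ℕ) := [(0,1),(1,2),(2,3),(3,4),(4,5),(5,6),(6,7),(7,8),(8,0),(9,0),(9,3),(9,6)]

/-- The edges of `E2`. -/
def L2 : List (ℕ × ℕ) := [(0,1),(1,2),(2,3),(3,4),(4,0),(1,5),(5,6),(6,7),(7,0),(3,8),(8,9),(9,6)]

lemma E1_adj (a b : Fin 10) : E1.Adj a b ↔ ladj L1 a b = true := by
  simp only [E1, fromEdgeSet_adj, Set.mem_insert_iff, Set.mem_singleton_iff, Sym2.eq_iff]
  revert a b
  decide +kernel

lemma E2_adj (a b : Fin 10) : E2.Adj a b ↔ ladj L2 a b = true := by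
  simp only [E2, fromEdgeSet_adj, Set.mem_insert_iff, Set.mem_singleton_iff, Sym2.eq_iff]
  revert a b
  decide +kernel

lemma C3_adj (a b : Fin 3) : (cycleGraph 3).Adj a b ↔ a ≠ b := by
  revert a b; decide

lemma dart_E1 : dart E1 = 24 := by
  classical
  have : dart E1 = (Finset.univ.filter (fun p : Fin 10 × Fin 10 => ladj L1 p.1 p.2 = true)).card := by
    unfold dart; congr 1; ext p; simp [E1_adj]
  rw [this]; decide +kernel

lemma dart_E2 : dart E2 = 24 := by
  classical
  have : dart E2 = (Finset.univ.filter (fun p : Fin 10 × Fin 10 => ladj L2 p.1 p.2 = true)).card := by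
    unfold dart; congr 1; ext p; simp [E2_adj]
  rw [this]; decide +kernel

lemma dart_C3 : dart (cycleGraph 3) = 6 := by
  classical
  have : dart (cycleGraph 3) = (Finset.univ.filter (fun p : Fin 3 × Fin 3 => p.1 ≠ p.2)).card := by
    unfold dart; congr 1; ext p; simp [C3_adj]
  rw [this]; decide +kernel

lemma noiso_E1 (a : Fin 10) : ∃ b, E1.Adj a b := by
  simp only [E1_adj]; revert a; decide +kernel

lemma noiso_E2 (a : Fin 10) : ∃ b, E2.Adj a b := by
  simp only [E2_adj]; revert a; decide +kernel

lemma noiso_C3 (a : Fin 3) : ∃ b, (cycleGraph 3).Adj a b := by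
  simp only [C3_adj]; revert a; decide +kernel

lemma IsCopy.adj {W : Type} {n : ℕ} {K : SimpleGraph W} {E : SimpleGraph (Fin n)}
    {σ : Fin n → W} (h : IsCopy K E σ) (a b : Fin n) : K.Adj (σ a) (σ b) ↔ E.Adj a b := by
  rw [h.2]
  constructor
  · rintro ⟨c, d, h1, h2, h3⟩
    rwa [← h.1 h2, ← h.1 h3]
  · intro h1; exact ⟨a, b, h1, rfl, rfl⟩

lemma IsCopy.support {W : Type} {n : ℕ} {K : SimpleGraph W} {E : SimpleGraph (Fin n)}
    {σ : Fin n → W} (h : IsCopy K E σ) (hE : ∀ a, ∃ b, E.Adj a b) : K.support = Set.range σ := by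
  ext x
  constructor
  · rintro ⟨y, hy⟩
    obtain ⟨a, b, -, h2, -⟩ := (h.2 _ _).1 hy
    exact ⟨a, h2⟩
  · rintro ⟨a, rfl⟩
    obtain ⟨b, hb⟩ := hE a
    exact ⟨σ b, (h.adj a b).2 hb⟩

lemma IsCopy.ncard {W : Type} {n : ℕ} {K : SimpleGraph W} {E : SimpleGraph (Fin n)}
    {σ : Fin n → W} (h : IsCopy K E σ) (hE : ∀ a, ∃ b, E.Adj a b) : K.support.ncard = n := by
  rw [h.support hE, ← Set.image_univ, Set.ncard_image_of_injective _ h.1]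
  simp

lemma IsCopy.dart {W : Type} [Fintype W] {n : ℕ} {K : SimpleGraph W} {E : SimpleGraph (Fin n)}
    {σ : Fin n → W} (h : IsCopy K E σ) : dart K = dart E := by
  classical
  unfold _root_.dart
  symm
  refine Finset.card_bij (fun p _ => (σ p.1, σ p.2)) ?_ ?_ ?_
  · rintro ⟨a, b⟩ h1; simpa [h.adj] using h1
  · rintro ⟨a, b⟩ _ ⟨c, d⟩ _ h1
    simp only [Prod.mk.injEq] at h1
    rw [h.1 h1.1, h.1 h1.2]
  · rintro ⟨x, y⟩ h1
    simp only [Finset.mem_filter, Finset.mem_univ, true_and] at h1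
    obtain ⟨a, b, h2, rfl, rfl⟩ := (h.2 _ _).1 h1
    exact ⟨(a, b), by simpa using h2, rfl⟩

lemma A5_irrefl : ∀ i, ¬ A5 i i := by decide

section
open Classical

/-- Number of adjacent pairs in `A × B`. -/
noncomputable def ee {V : Type} (G : SimpleGraph V) (A B : Finset V) : ℕ :=
  ((A ×ˢ B).filter (fun p => G.Adj p.1 p.2)).card

/-- The potential of the induced subgraph on `S`. -/
noncomputable def PP {V : Type} (G : SimpleGraph V) (S : Finset V) : ℤ :=
  5 * (S.card : ℤ) - 2 * (ee G S S : ℤ)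

lemma pot_eq {V : Type} [Fintype V] (G : SimpleGraph V) : pot G = PP G Finset.univ := by
  have h := dart_eq G
  have h2 : ee G Finset.univ Finset.univ = dart G := by
    unfold ee dart; rw [Finset.univ_product_univ]
  unfold pot PP
  rw [h2, h, Finset.card_univ]; push_cast; ring

lemma ee_comm {V : Type} (G : SimpleGraph V) (A B : Finset V) : ee G A B = ee G B A := by
  unfold ee
  refine Finset.card_bij (fun p _ => (p.2, p.1)) ?_ ?_ ?_
  · rintro ⟨a, b⟩ h; simp at h ⊢; exact ⟨⟨h.1.2, h.1.1⟩, h.2.symm⟩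
  · rintro ⟨a, b⟩ _ ⟨c, d⟩ _ h; simp at h ⊢; tauto
  · rintro ⟨a, b⟩ h; simp at h; exact ⟨(b, a), by simp; exact ⟨⟨h.1.2, h.1.1⟩, h.2.symm⟩, rfl⟩

lemma ee_union {V : Type} (G : SimpleGraph V) (S Y : Finset V) (h : Disjoint S Y) :
    ee G (S ∪ Y) (S ∪ Y) = ee G S S + ee G Y Y + 2 * ee G Y S := by
  have h1 : ∀ B, ee G (S ∪ Y) B = ee G S B + ee G Y B := by
    intro B
    unfold ee
    rw [Finset.union_product, Finset.filter_union, Finset.card_union_of_disjoint]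
    apply Finset.disjoint_filter_filter
    rw [Finset.disjoint_product]; exact Or.inl h
  rw [h1, ee_comm G S, ee_comm G Y, h1, h1, ee_comm G S Y]; ring

/-- The graph obtained from `G` by collapsing `S` onto a 5-cycle according to `f`. -/
def redG {V : Type} (G : SimpleGraph V) (S : Finset V) (f : V → Fin 5) : SimpleGraph (V ⊕ Fin 5) where
  Adj x y := match x, y with
    | .inl a, .inl b => a ∉ S ∧ b ∉ S ∧ G.Adj a b
    | .inl a, .inr i => a ∉ S ∧ ∃ s ∈ S, f s = i ∧ G.Adj a s
    | .inr i, .inl a => a ∉ S ∧ ∃ s ∈ S, f s = i ∧ G.Adj a s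
    | .inr i, .inr j => (∃ s ∈ S, f s = i) ∧ (∃ s ∈ S, f s = j) ∧ A5 i j
  symm := ⟨by
    rintro (a | i) (b | j) h
    · exact ⟨h.2.1, h.1, h.2.2.symm⟩
    · exact h
    · exact h
    · exact ⟨h.2.1, h.1, A5_symm h.2.2⟩⟩
  loopless := ⟨by
    rintro (a | i) h
    · exact G.loopless.irrefl _ h.2.2
    · exact A5_irrefl i h.2.2⟩

lemma red_not_col {V : Type} {G : SimpleGraph V} (hG : Critical52 G) (S : Finset V)
    (f : V → Fin 5) (hf : ColOn G S f) : ¬ ∃ g, IsCol (redG G S f) g := by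
  rintro ⟨g, hg⟩
  apply not_col hG (fun v => if v ∈ S then g (.inr (f v)) else g (.inl v))
  intro a b hab
  by_cases ha : a ∈ S <;> by_cases hb : b ∈ S <;> simp only [ha, hb, if_true, if_false]
  · exact hg _ _ ⟨⟨a, ha, rfl⟩, ⟨b, hb, rfl⟩, hf a ha b hb hab⟩
  · exact hg (.inr (f a)) (.inl b) ⟨hb, a, ha, rfl, hab.symm⟩
  · exact hg (.inl a) (.inr (f b)) ⟨ha, b, hb, rfl, hab⟩
  · exact hg (.inl a) (.inl b) ⟨ha, hb, hab⟩

lemma red_support {V : Type} [Fintype V] (G : SimpleGraph V) (S : Finset V)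
    (f : V → Fin 5) (h : (S.image f).card < S.card) :
    (redG G S f).support.ncard < Fintype.card V := by
  have hsub : (redG G S f).support ⊆ ((Sᶜ.disjSum (S.image f) : Finset (V ⊕ Fin 5)) : Set (V ⊕ Fin 5)) := by
    rintro (a | i) ⟨y, hy⟩
    · rcases y with b | j
      · simpa using hy.1
      · simpa using hy.1
    · rcases y with b | j
      · obtain ⟨-, s, hs, hs', -⟩ := hy
        simp; exact ⟨s, hs, hs'⟩
      · simpa using hy.1
  have h1 := Set.ncard_le_ncard hsub (Set.toFinite _)
  rw [Set.ncard_coe_finset, Finset.card_disjSum, Finset.card_compl] at h1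
  have := Finset.card_le_univ S
  omega

/-- Potential of the subgraph of the 5-cycle induced by `X`. -/
def CP (X : Finset (Fin 5)) : ℤ :=
  5 * (X.card : ℤ) - 2 * (((X ×ˢ X).filter (fun p => A5 p.1 p.2)).card : ℤ)

lemma CP_ge : ∀ X : Finset (Fin 5), X.Nonempty → 5 ≤ CP X := by decide +kernel

lemma CP_cases : ∀ X : Finset (Fin 5), X.Nonempty → CP X ≤ 6 →
    (X.card = 1 ∧ CP X = 5) ∨ (X.card = 2 ∧ CP X = 6 ∧ ∀ i ∈ X, ∀ j ∈ X, i ≠ j → A5 i j) ∨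
    (X.card = 5 ∧ CP X = 5) := by decide +kernel

lemma dart_sum {V : Type} [Fintype V] (K : SimpleGraph (V ⊕ Fin 5)) :
    dart K = (Finset.univ.filter (fun p : V × V => K.Adj (.inl p.1) (.inl p.2))).card
      + 2 * (Finset.univ.filter (fun p : V × Fin 5 => K.Adj (.inl p.1) (.inr p.2))).card
      + (Finset.univ.filter (fun p : Fin 5 × Fin 5 => K.Adj (.inr p.1) (.inr p.2))).card := by
  unfold dart
  simp only [Finset.card_filter, ← Finset.univ_product_univ, Finset.sum_product,
    Fintype.sum_sum_type, Finset.sum_add_distrib]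
  have : ∑ x : Fin 5, ∑ x_1 : V, (if K.Adj (Sum.inr x) (Sum.inl x_1) then 1 else 0) =
     ∑ x : V, ∑ x_1 : Fin 5, (if K.Adj (Sum.inl x) (Sum.inr x_1) then 1 else 0) := by
    rw [Finset.sum_comm]
    refine Finset.sum_congr rfl fun a _ => Finset.sum_congr rfl fun b _ => ?_
    rw [K.adj_comm]
  rw [this]; ring

lemma support_sum {V : Type} [Fintype V] (K : SimpleGraph (V ⊕ Fin 5)) :
    K.support.ncard = (Finset.univ.filter (fun v : V => Sum.inl v ∈ K.support)).card +
      (Finset.univ.filter (fun i : Fin 5 => Sum.inr i ∈ K.support)).card := by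
  rw [← Finset.card_disjSum, ← Set.ncard_coe_finset]
  congr 1
  ext (a | i) <;> simp

end

section
open Classical

/-- Vertices outside `S` used by `K`. -/
noncomputable def Yf {V : Type} [Fintype V] (K : SimpleGraph (V ⊕ Fin 5)) : Finset V :=
  Finset.univ.filter (fun v : V => Sum.inl v ∈ K.support)

/-- Colours used by `K`. -/
noncomputable def Xf {V : Type} [Fintype V] (K : SimpleGraph (V ⊕ Fin 5)) : Finset (Fin 5) :=
  Finset.univ.filter (fun i : Fin 5 => Sum.inr i ∈ K.support)

lemma kYY_sub {V : Type} [Fintype V] {G : SimpleGraph V} {S : Finset V} {f : V → Fin 5}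
    {K : SimpleGraph (V ⊕ Fin 5)} (hK : K ≤ redG G S f) :
    (Finset.univ.filter (fun p : V × V => K.Adj (.inl p.1) (.inl p.2))) ⊆
      ((Yf K ×ˢ Yf K).filter (fun p => G.Adj p.1 p.2)) := by
  rintro ⟨a, b⟩ h
  simp only [Finset.mem_filter, Finset.mem_univ, true_and, Finset.mem_product, Yf] at h ⊢
  exact ⟨⟨⟨_, h⟩, ⟨_, h.symm⟩⟩, (hK h).2.2⟩

lemma kYX_sub {V : Type} [Fintype V] {G : SimpleGraph V} {S : Finset V} {f : V → Fin 5}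
    {K : SimpleGraph (V ⊕ Fin 5)} (hK : K ≤ redG G S f) :
    (Finset.univ.filter (fun p : V × Fin 5 => K.Adj (.inl p.1) (.inr p.2))) ⊆
      ((Yf K ×ˢ S).filter (fun p => G.Adj p.1 p.2)).image (fun p => (p.1, f p.2)) := by
  rintro ⟨a, i⟩ h
  simp only [Finset.mem_filter, Finset.mem_univ, true_and, Finset.mem_product, Yf,
    Finset.mem_image, Prod.exists, Prod.mk.injEq] at h ⊢
  obtain ⟨-, s, hs, hs', h2⟩ := hK h
  exact ⟨a, s, ⟨⟨⟨_, h⟩, hs⟩, h2⟩, rfl, hs'⟩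

lemma kXX_sub {V : Type} [Fintype V] {G : SimpleGraph V} {S : Finset V} {f : V → Fin 5}
    {K : SimpleGraph (V ⊕ Fin 5)} (hK : K ≤ redG G S f) :
    (Finset.univ.filter (fun p : Fin 5 × Fin 5 => K.Adj (.inr p.1) (.inr p.2))) ⊆
      ((Xf K ×ˢ Xf K).filter (fun p => A5 p.1 p.2)) := by
  rintro ⟨a, b⟩ h
  simp only [Finset.mem_filter, Finset.mem_univ, true_and, Finset.mem_product, Xf] at h ⊢
  exact ⟨⟨⟨_, h⟩, ⟨_, h.symm⟩⟩, (hK h).2.2⟩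

lemma Yf_disj {V : Type} [Fintype V] {G : SimpleGraph V} {S : Finset V} {f : V → Fin 5}
    {K : SimpleGraph (V ⊕ Fin 5)} (hK : K ≤ redG G S f) : Disjoint S (Yf K) := by
  rw [Finset.disjoint_left]
  intro a ha h
  simp only [Finset.mem_filter, Finset.mem_univ, true_and, Yf] at h
  obtain ⟨y, hy⟩ := h
  have h2 := hK hy
  rcases y with b | j
  · exact h2.1 ha
  · exact h2.1 ha

lemma Xf_ne {V : Type} [Fintype V] {G : SimpleGraph V} (hG : Critical52 G) {S : Finset V}
    (hS : S.Nonempty) {f : V → Fin 5}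
    {K : SimpleGraph (V ⊕ Fin 5)} (hK : K ≤ redG G S f) (hc : ¬ ∃ f, IsCol K f) :
    (Xf K).Nonempty := by
  by_contra hX
  rw [Finset.not_nonempty_iff_eq_empty] at hX
  have hX' : ∀ i, Sum.inr i ∉ K.support := by
    intro i hi
    have : i ∈ Xf K := by simp [Xf, hi]
    simp [hX] at this
  have hne : Sᶜ ≠ Finset.univ := by
    obtain ⟨s, hs⟩ := hS
    intro h
    have : s ∈ Sᶜ := by rw [h]; simp
    simp at this; exact this hs
  obtain ⟨g, hg⟩ := exists_colOn hG _ hne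
  apply hc
  refine ⟨Sum.elim g (fun _ => 0), ?_⟩
  rintro (a | i) (b | j) h
  · have h2 := hK h
    exact hg a (by simpa using h2.1) b (by simpa using h2.2.1) h2.2.2
  · exact (hX' j ⟨_, h.symm⟩).elim
  · exact (hX' i ⟨_, h⟩).elim
  · exact (hX' i ⟨_, h⟩).elim

lemma Yf_ne {V : Type} [Fintype V] {G : SimpleGraph V} {S : Finset V}
    {f : V → Fin 5}
    {K : SimpleGraph (V ⊕ Fin 5)} (hK : K ≤ redG G S f) (hc : ¬ ∃ f, IsCol K f) :
    (Yf K).Nonempty := by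
  by_contra hX
  rw [Finset.not_nonempty_iff_eq_empty] at hX
  have hX' : ∀ i, Sum.inl i ∉ K.support := by
    intro i hi
    have : i ∈ Yf K := by simp [Yf, hi]
    simp [hX] at this
  apply hc
  refine ⟨Sum.elim (fun _ => 0) id, ?_⟩
  rintro (a | i) (b | j) h
  · exact (hX' a ⟨_, h⟩).elim
  · exact (hX' a ⟨_, h⟩).elim
  · exact (hX' b ⟨_, h.symm⟩).elim
  · exact (hK h).2.2

/-- Accounting identity for the potential method. -/
lemma account {V : Type} [Fintype V] {G : SimpleGraph V} {S : Finset V} {f : V → Fin 5}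
    {K : SimpleGraph (V ⊕ Fin 5)} (hK : K ≤ redG G S f) :
    ∃ l1 l2 l3 : ℕ,
     ee G (Yf K) (Yf K) = (Finset.univ.filter (fun p : V × V => K.Adj (.inl p.1) (.inl p.2))).card + l1 ∧
     ee G (Yf K) S = (Finset.univ.filter (fun p : V × Fin 5 => K.Adj (.inl p.1) (.inr p.2))).card + l2 ∧
     ((Xf K ×ˢ Xf K).filter (fun p => A5 p.1 p.2)).card =
       (Finset.univ.filter (fun p : Fin 5 × Fin 5 => K.Adj (.inr p.1) (.inr p.2))).card + l3 ∧
     PP G (S ∪ Yf K) = PP G S + (5 * (K.support.ncard : ℤ) - 2 * (dart K : ℤ)) - CP (Xf K)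
        - 2 * l1 - 4 * l2 - 2 * l3 := by
  have h1 := Finset.card_le_card (kYY_sub hK)
  have h2 := (Finset.card_le_card (kYX_sub hK)).trans Finset.card_image_le
  have h3 := Finset.card_le_card (kXX_sub hK)
  obtain ⟨l1, hl1⟩ := Nat.exists_eq_add_of_le h1
  obtain ⟨l2, hl2⟩ := Nat.exists_eq_add_of_le h2
  obtain ⟨l3, hl3⟩ := Nat.exists_eq_add_of_le h3
  refine ⟨l1, l2, l3, hl1, hl2, hl3, ?_⟩
  have e1 := ee_union G S _ (Yf_disj hK)
  have e2 := dart_sum K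
  have e3 := support_sum K
  have e4 : (S ∪ Yf K).card = S.card + (Yf K).card := Finset.card_union_of_disjoint (Yf_disj hK)
  unfold PP CP
  have e5 : ee G (Yf K) (Yf K) = (Finset.univ.filter (fun p : V × V => K.Adj (.inl p.1) (.inl p.2))).card + l1 := hl1
  have e6 : ee G (Yf K) S = (Finset.univ.filter (fun p : V × Fin 5 => K.Adj (.inl p.1) (.inr p.2))).card + l2 := hl2
  change K.support.ncard = (Yf K).card + (Xf K).card at e3
  omega

/-- The four outcomes. -/
def Outc {W : Type} [Fintype W] (K1 : SimpleGraph W) : Prop :=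
      ((∃ σ, IsCopy K1 (cycleGraph 3) σ) ∨ (∃ σ, IsCopy K1 E1 σ) ∨
       (∃ σ, IsCopy K1 E2 σ) ∨ 5 * K1.support.ncard ≤ 2 * dart K1 + 1)

lemma Outc_le {W : Type} [Fintype W] {K : SimpleGraph W} (h : Outc K) :
    (5 * (K.support.ncard : ℤ) - 2 * (dart K : ℤ)) ≤ 3 := by
  rcases h with ⟨σ, h⟩ | ⟨σ, h⟩ | ⟨σ, h⟩ | h
  · rw [h.ncard noiso_C3, h.dart, dart_C3]; norm_num
  · rw [h.ncard noiso_E1, h.dart, dart_E1]; norm_num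
  · rw [h.ncard noiso_E2, h.dart, dart_E2]; norm_num
  · omega

lemma PP_inj {V : Type} [Fintype V] {G : SimpleGraph V} {S : Finset V} (hS : S.Nonempty)
    {f : V → Fin 5} (hf : ColOn G S f) (hi : ¬ (S.image f).card < S.card) : 5 ≤ PP G S := by
  have hc : (S.image f).card = S.card := le_antisymm Finset.card_image_le (not_lt.1 hi)
  have hinj := Finset.card_image_iff.1 hc
  have h1 := CP_ge (S.image f) (hS.image f)
  have h2 : ee G S S ≤ (((S.image f) ×ˢ (S.image f)).filter (fun p => A5 p.1 p.2)).card := by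
    unfold ee
    refine Finset.card_le_card_of_injOn (fun p => (f p.1, f p.2)) ?_ ?_
    · rintro ⟨a, b⟩ h
      simp only [Finset.coe_filter, Finset.mem_product, Set.mem_ofPred_eq] at h
      simp only [Finset.coe_filter, Finset.mem_product, Set.mem_ofPred_eq]
      exact ⟨⟨Finset.mem_image_of_mem _ h.1.1, Finset.mem_image_of_mem _ h.1.2⟩, hf a h.1.1 b h.1.2 h.2⟩
    · rintro ⟨a, b⟩ h ⟨c, d⟩ h' e
      simp only [Finset.coe_filter, Finset.mem_product, Set.mem_ofPred_eq] at h h'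
      simp only [Prod.mk.injEq] at e
      rw [hinj h.1.1 h'.1.1 e.1, hinj h.1.2 h'.1.2 e.2]
  unfold CP at h1
  unfold PP
  rw [hc] at h1
  omega

lemma LB {V : Type} [Fintype V] {G : SimpleGraph V} (hG : SmallestCex G) :
    ∀ (n : ℕ) (S : Finset V), Sᶜ.card = n → S.Nonempty → S ≠ Finset.univ → 4 ≤ PP G S := by
  intro n
  induction n using Nat.strong_induction_on with
  | _ n ih =>
    intro S hn hS hu
    obtain ⟨f, hf⟩ := exists_colOn hG.1 S hu
    by_cases hi : (S.image f).card < S.card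
    · obtain ⟨K, hK, hc, ho⟩ := exists_small hG _ (red_not_col hG.1 S f hf) (red_support G S f hi)
      obtain ⟨l1, l2, l3, -, -, -, hp⟩ := account hK
      have h3 := Outc_le ho
      have h5 := CP_ge _ (Xf_ne hG.1 hS hK hc)
      obtain ⟨y, hy⟩ := Yf_ne hK hc
      have hyS : y ∉ S := fun h => Finset.disjoint_left.1 (Yf_disj hK) h hy
      have h2 : 2 ≤ PP G (S ∪ Yf K) := by
        by_cases hun : S ∪ Yf K = Finset.univ
        · rw [hun, ← pot_eq]; exact hG.2.2.2.2.1
        · have := ih (S ∪ Yf K)ᶜ.card (by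
            rw [← hn]
            apply Finset.card_lt_card
            rw [Finset.compl_ssubset_compl, Finset.ssubset_iff_of_subset Finset.subset_union_left]
            exact ⟨y, by simp [hy], hyS⟩) _ rfl (hS.mono Finset.subset_union_left) hun
          omega
      omega
    · have := PP_inj hS hf hi; omega

lemma LB' {V : Type} [Fintype V] {G : SimpleGraph V} (hG : SmallestCex G) {S : Finset V}
    (hS : S.Nonempty) (hu : S ≠ Finset.univ) : 4 ≤ PP G S := LB hG _ S rfl hS hu

end

section
open Classical

/-- `K` is the whole reduction, without loss. -/
structure NL {V : Type} [Fintype V] (G : SimpleGraph V) (S : Finset V) (f : V → Fin 5)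
    (K : SimpleGraph (V ⊕ Fin 5)) : Prop where
  yy : ∀ a, a ∉ S → ∀ b, b ∉ S → (K.Adj (.inl a) (.inl b) ↔ G.Adj a b)
  yx : ∀ a, a ∉ S → ∀ i, (K.Adj (.inl a) (.inr i) ↔ ∃ s ∈ S, f s = i ∧ G.Adj a s)
  inj : ∀ a, a ∉ S → ∀ s ∈ S, ∀ t ∈ S, G.Adj a s → G.Adj a t → f s = f t → s = t
  xx : ∀ i ∈ Xf K, ∀ j ∈ Xf K, (K.Adj (.inr i) (.inr j) ↔ A5 i j)
  nS : ∀ a, Sum.inl a ∈ K.support ↔ a ∉ S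
  card : K.support.ncard = Sᶜ.card + (Xf K).card

lemma NL.mem {V : Type} [Fintype V] {G : SimpleGraph V} {S : Finset V} {f : V → Fin 5}
    {K : SimpleGraph (V ⊕ Fin 5)} (h : NL G S f K) {a s : V} (ha : a ∉ S) (hs : s ∈ S)
    (has : G.Adj a s) : f s ∈ Xf K := by
  have := (h.yx a ha (f s)).2 ⟨s, hs, rfl, has⟩
  simp only [Xf, Finset.mem_filter, Finset.mem_univ, true_and]
  exact ⟨_, this.symm⟩

lemma struct0 {V : Type} [Fintype V] {G : SimpleGraph V} (hG : SmallestCex G) {S : Finset V}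
    (hS : S.Nonempty) (hu : S ≠ Finset.univ) {f : V → Fin 5} (hf : ColOn G S f)
    (hi : (S.image f).card < S.card) (hP : PP G S ≤ 5) :
    ∃ K, NL G S f K ∧
     (((∃ σ, IsCopy K (cycleGraph 3) σ) ∧ (Xf K).card = 1 ∧ Sᶜ.card = 2) ∨
      ((∃ σ, IsCopy K (cycleGraph 3) σ) ∧ (Xf K).card = 2 ∧ Sᶜ.card = 1 ∧ PP G S = 5 ∧
         ∀ i ∈ Xf K, ∀ j ∈ Xf K, i ≠ j → A5 i j) ∨
      (((∃ σ, IsCopy K E1 σ) ∨ (∃ σ, IsCopy K E2 σ)) ∧ (Xf K).card = 1 ∧ Sᶜ.card = 9 ∧ PP G S = 5) ∨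
      (((∃ σ, IsCopy K E1 σ) ∨ (∃ σ, IsCopy K E2 σ)) ∧ (Xf K).card = 5 ∧ Sᶜ.card = 5 ∧ PP G S = 5)) := by
  obtain ⟨K, hK, hc, ho⟩ := exists_small hG _ (red_not_col hG.1 S f hf) (red_support G S f hi)
  obtain ⟨l1, l2, l3, hl1, hl2, hl3, hp⟩ := account hK
  have h3 := Outc_le ho
  have hXne := Xf_ne hG.1 hS hK hc
  have h5 := CP_ge _ hXne
  have hun : S ∪ Yf K = Finset.univ := by
    by_contra hun
    have := LB' hG (hS.mono (Finset.subset_union_left (s₂ := Yf K))) hun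
    omega
  have h2 : 2 ≤ PP G (S ∪ Yf K) := by rw [hun, ← pot_eq]; exact hG.2.2.2.2.1
  have hl1' : l1 = 0 := by omega
  have hl2' : l2 = 0 := by omega
  have hl3' : l3 = 0 := by omega
  subst hl1' hl2' hl3'
  have hYS : ∀ a, a ∈ Yf K ↔ a ∉ S := by
    intro a
    constructor
    · exact fun h h' => Finset.disjoint_left.1 (Yf_disj hK) h' h
    · intro h
      have : a ∈ S ∪ Yf K := by rw [hun]; simp
      simpa [h] using this
  have hYS' : Yf K = Sᶜ := by ext a; rw [hYS]; simp
  have hcard : K.support.ncard = Sᶜ.card + (Xf K).card := by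
    rw [← hYS']; exact support_sum K
  have e1 := Finset.eq_of_subset_of_card_le (kYY_sub hK) (by
    change ee G (Yf K) (Yf K) ≤ _; rw [hl1]; simp)
  have c2 := Finset.card_le_card (kYX_sub hK)
  have c2' : (((Yf K ×ˢ S).filter (fun p => G.Adj p.1 p.2)).image (fun p => (p.1, f p.2))).card ≤ ((Yf K ×ˢ S).filter (fun p => G.Adj p.1 p.2)).card := Finset.card_image_le
  have c3 : ((Yf K ×ˢ S).filter (fun p => G.Adj p.1 p.2)).card = _ := hl2
  have e2 := Finset.eq_of_subset_of_card_le (kYX_sub hK) (by omega)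
  have e2' := Finset.card_image_iff.1 (le_antisymm c2' (by omega))
  have e3 := Finset.eq_of_subset_of_card_le (kXX_sub hK) (by rw [hl3]; simp)
  have hNL : NL G S f K := by
    refine ⟨?_, ?_, ?_, ?_, ?_, hcard⟩
    · intro a ha b hb
      have := congrArg (fun Z => (a, b) ∈ Z) e1
      simpa [hYS, ha, hb] using this
    · intro a ha i
      have := congrArg (fun Z => (a, i) ∈ Z) e2
      simp [hYS, ha] at this
      rw [this]
      constructor
      · rintro ⟨b, ⟨h1, h2⟩, h3⟩; exact ⟨b, h1, h3, h2⟩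
      · rintro ⟨b, h1, h3, h2⟩; exact ⟨b, ⟨h1, h2⟩, h3⟩
    · intro a ha s hs t ht has hat hst
      have := @e2' (a, s) (by simp [hYS, ha, hs, has]) (a, t) (by simp [hYS, ha, ht, hat]) (by simp [hst])
      simpa using this
    · intro i hi j hj
      have := congrArg (fun Z => (i, j) ∈ Z) e3
      simpa [hi, hj] using this
    · intro a; rw [← hYS]; simp [Yf]
  refine ⟨K, hNL, ?_⟩
  rcases ho with ⟨σ, h⟩ | ⟨σ, h⟩ | ⟨σ, h⟩ | h
  · rw [h.ncard noiso_C3, h.dart, dart_C3] at hp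
    rw [h.ncard noiso_C3] at hcard
    rcases CP_cases (Xf K) hXne (by omega) with h6 | ⟨h6, h7, h8⟩ | h6
    · exact Or.inl ⟨⟨σ, h⟩, h6.1, by omega⟩
    · exact Or.inr (Or.inl ⟨⟨σ, h⟩, h6, by omega, by omega, h8⟩)
    · omega
  · rw [h.ncard noiso_E1, h.dart, dart_E1] at hp
    rw [h.ncard noiso_E1] at hcard
    rcases CP_cases (Xf K) hXne (by omega) with h6 | ⟨h6, h7, h8⟩ | h6
    · exact Or.inr (Or.inr (Or.inl ⟨Or.inl ⟨σ, h⟩, h6.1, by omega, by omega⟩))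
    · omega
    · exact Or.inr (Or.inr (Or.inr ⟨Or.inl ⟨σ, h⟩, h6.1, by omega, by omega⟩))
  · rw [h.ncard noiso_E2, h.dart, dart_E2] at hp
    rw [h.ncard noiso_E2] at hcard
    rcases CP_cases (Xf K) hXne (by omega) with h6 | ⟨h6, h7, h8⟩ | h6
    · exact Or.inr (Or.inr (Or.inl ⟨Or.inr ⟨σ, h⟩, h6.1, by omega, by omega⟩))
    · omega
    · exact Or.inr (Or.inr (Or.inr ⟨Or.inr ⟨σ, h⟩, h6.1, by omega, by omega⟩))
  · omega

end

/-- Attachment vertices of `S`. -/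
def inA {V : Type} (G : SimpleGraph V) (S : Finset V) (s : V) : Prop :=
  s ∈ S ∧ ∃ a, a ∉ S ∧ G.Adj a s

section
open Classical

lemma lemR {V : Type} [Fintype V] {G : SimpleGraph V} (hG : Critical52 G) {S C : Finset V}
    (hC : C ⊆ S) (hne : C ≠ S) (hA : ∀ s, inA G S s → s ∈ C)
    (hu : S ≠ Finset.univ)
    (hτ : ∀ f g, ColOn G C f → ColOn G C g →
      ∃ τ : Fin 5 → Fin 5, (∀ x y, A5 x y → A5 (τ x) (τ y)) ∧ ∀ c ∈ C, g c = τ (f c)) : False := by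
  obtain ⟨f, hf⟩ := exists_colOn hG S hu
  obtain ⟨g, hg⟩ := exists_colOn hG (Sᶜ ∪ C) (by
    intro h
    apply hne
    apply Finset.Subset.antisymm hC
    intro s hs
    have : s ∈ Sᶜ ∪ C := by rw [h]; simp
    simpa [hs] using this)
  obtain ⟨τ, h1, h2⟩ := hτ f g (fun a ha b hb => hf a (hC ha) b (hC hb))
    (fun a ha b hb => hg a (by simp [ha]) b (by simp [hb]))
  apply not_col hG (fun v => if v ∈ S then τ (f v) else g v)
  intro a b hab
  by_cases ha : a ∈ S <;> by_cases hb : b ∈ S <;> simp only [ha, hb, if_true, if_false]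
  · exact h1 _ _ (hf a ha b hb hab)
  · have hc := hA a ⟨ha, b, hb, hab.symm⟩
    rw [← h2 a hc]
    exact hg a (by simp [hc]) b (by simp [hb]) hab
  · have hc := hA b ⟨hb, a, ha, hab⟩
    rw [← h2 b hc]
    exact hg a (by simp [ha]) b (by simp [hc]) hab
  · exact hg a (by simp [ha]) b (by simp [hb]) hab

lemma A5_rot : ∀ z x y : Fin 5, A5 x y → A5 (x + z) (y + z) := by decide

lemma lemR1 {V : Type} [Fintype V] {G : SimpleGraph V} (hG : Critical52 G) {S : Finset V}
    (hS : 2 ≤ S.card) (hu : S ≠ Finset.univ)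
    (hA : ∀ s t, inA G S s → inA G S t → s = t) : False := by
  have : ∃ a ∈ S, ∀ s, inA G S s → s = a := by
    by_cases h : ∃ a, inA G S a
    · obtain ⟨a, ha⟩ := h
      exact ⟨a, ha.1, fun s hs => hA s a hs ha⟩
    · obtain ⟨a, ha⟩ := Finset.card_pos.1 (by omega : 0 < S.card)
      exact ⟨a, ha, fun s hs => (h ⟨s, hs⟩).elim⟩
  obtain ⟨a, ha, h⟩ := this
  refine lemR (C := {a}) hG (by simpa using ha) ?_ (by simpa using h) hu ?_
  · intro h; rw [← h] at hS; simp at hS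
  · intro f g _ _
    refine ⟨fun z => z + (g a - f a), fun x y => A5_rot _ x y, ?_⟩
    intro c hc
    simp at hc; subst hc
    simp

lemma walk5 : ∀ x0 x1 x2 x3 x4 : Fin 5, A5 x0 x1 → A5 x1 x2 → A5 x2 x3 → A5 x3 x4 → A5 x4 x0 →
    ∃ e : Fin 5, (e = 1 ∨ e = 4) ∧ x1 = x0 + e ∧ x2 = x0 + 2 * e ∧ x3 = x0 + 3 * e ∧ x4 = x0 + 4 * e := by
  decide +kernel

lemma A5_aff : ∀ e : Fin 5, (e = 1 ∨ e = 4) → ∀ z w x y : Fin 5, A5 x y →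
    A5 (z + e * (x - w)) (z + e * (y - w)) := by decide +kernel

lemma lemR5 {V : Type} [Fintype V] {G : SimpleGraph V} (hG : Critical52 G) {S : Finset V}
    (hS : 6 ≤ S.card) (hu : S ≠ Finset.univ) (c0 c1 c2 c3 c4 : V)
    (hc0 : c0 ∈ S) (hc1 : c1 ∈ S) (hc2 : c2 ∈ S) (hc3 : c3 ∈ S) (hc4 : c4 ∈ S)
    (h01 : G.Adj c0 c1) (h12 : G.Adj c1 c2) (h23 : G.Adj c2 c3) (h34 : G.Adj c3 c4) (h40 : G.Adj c4 c0)
    (hA : ∀ s, inA G S s → s = c0 ∨ s = c1 ∨ s = c2 ∨ s = c3 ∨ s = c4) : False := by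
  have hw : ∀ f, ColOn G {c0, c1, c2, c3, c4} f → ∃ e : Fin 5, (e = 1 ∨ e = 4) ∧
      f c1 = f c0 + e ∧ f c2 = f c0 + 2 * e ∧ f c3 = f c0 + 3 * e ∧ f c4 = f c0 + 4 * e := by
    intro f hf
    exact walk5 _ _ _ _ _ (hf _ (by simp) _ (by simp) h01) (hf _ (by simp) _ (by simp) h12)
      (hf _ (by simp) _ (by simp) h23) (hf _ (by simp) _ (by simp) h34) (hf _ (by simp) _ (by simp) h40)
  refine lemR (C := {c0, c1, c2, c3, c4}) hG ?_ ?_ (by simpa using hA) hu ?_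
  · intro x hx; simp at hx; rcases hx with rfl | rfl | rfl | rfl | rfl <;> assumption
  · intro h
    have : ({c0, c1, c2, c3, c4} : Finset V).card ≤ 5 := Finset.card_le_five
    rw [h] at this; omega
  · intro f g hf hg
    obtain ⟨e, he, h1, h2, h3, h4⟩ := hw f hf
    obtain ⟨d, hd, k1, k2, k3, k4⟩ := hw g hg
    refine ⟨fun z => g c0 + (d * e) * (z - f c0), ?_, ?_⟩
    · intro x y hxy
      refine A5_aff (d * e) ?_ _ _ _ _ hxy
      rcases he with rfl | rfl <;> rcases hd with rfl | rfl <;> decide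
    · intro c hc
      have key : ∀ (a b : Fin 5), ∀ k : Fin 5, a + k * d = a + (d * e) * ((b + k * e) - b) := by
        intro a b k
        rcases he with rfl | rfl <;> rcases hd with rfl | rfl <;> revert a b k <;> decide
      simp at hc
      rcases hc with rfl | rfl | rfl | rfl | rfl
      · simp
      · dsimp only; rw [h1, k1]; simpa using key (g c0) (f c0) 1
      · dsimp only; rw [h2, k2]; exact key (g c0) (f c0) 2
      · dsimp only; rw [h3, k3]; exact key (g c0) (f c0) 3
      · dsimp only; rw [h4, k4]; exact key (g c0) (f c0) 4

lemma img_lt {V : Type} {S : Finset V} (h : 6 ≤ S.card) (f : V → Fin 5) :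
    (S.image f).card < S.card := by
  have := Finset.card_le_univ (S.image f)
  simp at this
  omega

lemma A_const {V : Type} [Fintype V] {G : SimpleGraph V} (hG : SmallestCex G) {S : Finset V}
    (hS : S.Nonempty) (hu : S ≠ Finset.univ) {f : V → Fin 5} (hf : ColOn G S f)
    (hi : (S.image f).card < S.card) (hP : PP G S ≤ 5) (hc : Sᶜ.card = 2 ∨ Sᶜ.card = 9) {s t : V}
    (hs : inA G S s) (ht : inA G S t) : f s = f t := by
  obtain ⟨K, hNL, h⟩ := struct0 hG hS hu hf hi hP
  obtain ⟨hs, a, ha, has⟩ := hs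
  obtain ⟨ht, b, hb, hbt⟩ := ht
  have hX : (Xf K).card = 1 := by omega
  obtain ⟨i, hX⟩ := Finset.card_eq_one.1 hX
  have h1 := hNL.mem ha hs has
  have h2 := hNL.mem hb ht hbt
  rw [hX] at h1 h2
  simp at h1 h2
  rw [h1, h2]

lemma C3_complete {W : Type} {K : SimpleGraph W} {σ : Fin 3 → W} (h : IsCopy K (cycleGraph 3) σ)
    {x y : W} (hx : x ∈ K.support) (hy : y ∈ K.support) (hxy : x ≠ y) : K.Adj x y := by
  rw [h.support noiso_C3] at hx hy
  obtain ⟨a, rfl⟩ := hx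
  obtain ⟨b, rfl⟩ := hy
  rw [h.adj, C3_adj]
  rintro rfl; exact hxy rfl

lemma mem_Xf {V : Type} [Fintype V] {K : SimpleGraph (V ⊕ Fin 5)} {i : Fin 5} :
    i ∈ Xf K ↔ Sum.inr i ∈ K.support := by simp [Xf]

lemma alpha2 {V : Type} [Fintype V] {G : SimpleGraph V} (hG : SmallestCex G) {S : Finset V}
    (hS : S.Nonempty) (hu : S ≠ Finset.univ) {f : V → Fin 5} (hf : ColOn G S f)
    (hi : (S.image f).card < S.card) (hP : PP G S ≤ 5) (hc : Sᶜ.card = 2) :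
    ∃ y1 y2 u v, y1 ≠ y2 ∧ (∀ x, x ∉ S ↔ x = y1 ∨ x = y2) ∧ G.Adj y1 y2 ∧ u ∈ S ∧ v ∈ S ∧
      (∀ s ∈ S, G.Adj y1 s ↔ s = u) ∧ (∀ s ∈ S, G.Adj y2 s ↔ s = v) := by
  obtain ⟨K, hNL, h⟩ := struct0 hG hS hu hf hi hP
  have hX : (Xf K).card = 1 ∧ ∃ σ, IsCopy K (cycleGraph 3) σ := by
    rcases h with h | h | h | h
    · exact ⟨h.2.1, h.1⟩
    all_goals omega
  obtain ⟨hX, σ, hσ⟩ := hX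
  obtain ⟨i, hX⟩ := Finset.card_eq_one.1 hX
  obtain ⟨y1, y2, hy, hSc⟩ := Finset.card_eq_two.1 hc
  have hm : ∀ x, x ∉ S ↔ x = y1 ∨ x = y2 := by
    intro x; rw [← Finset.mem_compl, hSc]; simp
  have h1 : y1 ∉ S := (hm _).2 (Or.inl rfl)
  have h2 : y2 ∉ S := (hm _).2 (Or.inr rfl)
  have hiX : Sum.inr i ∈ K.support := by rw [← mem_Xf, hX]; simp
  have key : ∀ y, y ∉ S → ∃ u ∈ S, ∀ s ∈ S, G.Adj y s ↔ s = u := by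
    intro y hy
    have := C3_complete hσ ((hNL.nS y).2 hy) hiX (by simp)
    obtain ⟨u, hu, hui, hyu⟩ := (hNL.yx y hy i).1 this
    refine ⟨u, hu, fun s hs => ⟨fun hys => ?_, fun h => h ▸ hyu⟩⟩
    refine hNL.inj y hy s hs u hu hys hyu ?_
    have := hNL.mem hy hs hys
    rw [hX] at this
    simp at this
    rw [this, hui]
  obtain ⟨u, hu1, hu2⟩ := key y1 h1
  obtain ⟨v, hv1, hv2⟩ := key y2 h2
  refine ⟨y1, y2, u, v, hy, hm, ?_, hu1, hv1, hu2, hv2⟩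
  rw [← hNL.yy y1 h1 y2 h2]
  exact C3_complete hσ ((hNL.nS y1).2 h1) ((hNL.nS y2).2 h2) (by simpa using hy)

lemma beta {V : Type} [Fintype V] {G : SimpleGraph V} (hG : SmallestCex G) {S : Finset V}
    (hS : S.Nonempty) (hu : S ≠ Finset.univ)
    (hi : 6 ≤ S.card) (hP : PP G S ≤ 5) (hc : Sᶜ.card = 1) :
    ∃ w u v, u ≠ v ∧ (∀ x, x ∉ S ↔ x = w) ∧ u ∈ S ∧ v ∈ S ∧
      (∀ s ∈ S, G.Adj w s ↔ s = u ∨ s = v) ∧ ∀ f, ColOn G S f → A5 (f u) (f v) := by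
  obtain ⟨w, hSc⟩ := Finset.card_eq_one.1 hc
  have hm : ∀ x, x ∉ S ↔ x = w := by
    intro x; rw [← Finset.mem_compl, hSc]; simp
  have hw : w ∉ S := (hm w).2 rfl
  have main : ∀ f, ColOn G S f → ∃ u v, u ≠ v ∧ u ∈ S ∧ v ∈ S ∧
      (∀ s ∈ S, G.Adj w s ↔ s = u ∨ s = v) ∧ A5 (f u) (f v) := by
    intro f hf
    obtain ⟨K, hNL, h⟩ := struct0 hG hS hu hf (img_lt hi f) hP
    have hX : (Xf K).card = 2 ∧ (∃ σ, IsCopy K (cycleGraph 3) σ) ∧ ∀ i ∈ Xf K, ∀ j ∈ Xf K, i ≠ j → A5 i j := by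
      rcases h with h | h | h | h
      · omega
      · exact ⟨h.2.1, h.1, h.2.2.2.2⟩
      · omega
      · omega
    obtain ⟨hX, ⟨σ, hσ⟩, hA⟩ := hX
    obtain ⟨i, j, hij, hX⟩ := Finset.card_eq_two.1 hX
    have hiX : i ∈ Xf K := by rw [hX]; simp
    have hjX : j ∈ Xf K := by rw [hX]; simp
    have k1 := C3_complete hσ ((hNL.nS w).2 hw) (mem_Xf.1 hiX) (by simp)
    have k2 := C3_complete hσ ((hNL.nS w).2 hw) (mem_Xf.1 hjX) (by simp)
    obtain ⟨u, hu, hui, hwu⟩ := (hNL.yx w hw i).1 k1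
    obtain ⟨v, hv, hvi, hwv⟩ := (hNL.yx w hw j).1 k2
    refine ⟨u, v, ?_, hu, hv, ?_, ?_⟩
    · rintro rfl; exact hij (hui.symm.trans hvi)
    · intro s hs
      constructor
      · intro hws
        have := hNL.mem hw hs hws
        rw [hX] at this
        simp at this
        rcases this with h | h
        · exact Or.inl (hNL.inj w hw s hs u hu hws hwu (h.trans hui.symm))
        · exact Or.inr (hNL.inj w hw s hs v hv hws hwv (h.trans hvi.symm))
      · rintro (rfl | rfl) <;> assumption
    · rw [hui, hvi]; exact hA i hiX j hjX hij
  obtain ⟨f0, hf0⟩ := exists_colOn hG.1 S hu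
  obtain ⟨u, v, huv, hu', hv', hn, -⟩ := main f0 hf0
  refine ⟨w, u, v, huv, hm, hu', hv', hn, ?_⟩
  intro f hf
  obtain ⟨a, b, hab, ha, hb, hn', hA⟩ := main f hf
  have ha2 := (hn a ha).1 ((hn' a ha).2 (Or.inl rfl))
  have hb2 := (hn b hb).1 ((hn' b hb).2 (Or.inr rfl))
  rcases ha2 with rfl | rfl <;> rcases hb2 with rfl | rfl
  · exact (hab rfl).elim
  · exact hA
  · exact A5_symm hA
  · exact (hab rfl).elim

end

/-- Squared cyclic difference. -/
def cd (x y : Fin 5) : Fin 5 := (x - y) * (x - y)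

set_option synthInstance.maxHeartbeats 400000 in
set_option synthInstance.maxSize 4000 in
lemma ext1 : ∀ x y z : Fin 5,
    (∃ a, A5 a x ∧ ∃ b, A5 a b ∧ ∃ c, A5 b c ∧ A5 c y ∧ ∃ d, A5 c d ∧ ∃ e, A5 d e ∧ A5 e z) ∨
    (cd x y = 1 ∧ cd x z = 4 ∧ cd y z = 1) := by decide +kernel

set_option synthInstance.maxHeartbeats 400000 in
set_option synthInstance.maxSize 4000 in
lemma ext2 : ∀ x y z : Fin 5,
    (∃ a, A5 a x ∧ ∃ b, A5 a b ∧ ∃ c, A5 b c ∧ A5 c y ∧ ∃ d, A5 b d ∧ ∃ e, A5 d e ∧ A5 e z) ∨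
    (cd x y = 1 ∧ cd x z = 4 ∧ cd y z = 4) := by decide +kernel

section
open Classical

/-- `S` has three attachment vertices whose relative colours are rigid. -/
def Rigid {V : Type} (G : SimpleGraph V) (S : Finset V) : Prop :=
  ∃ s : Fin 3 → V, (∀ k, s k ∈ S) ∧ (∀ t, inA G S t → ∃ k, t = s k) ∧
    ∃ d0 d1 d2 : Fin 5, d0 ≠ 0 ∧ d1 ≠ 0 ∧ d2 ≠ 0 ∧ ∀ f, ColOn G S f →
      cd (f (s 0)) (f (s 1)) = d0 ∧ cd (f (s 0)) (f (s 2)) = d1 ∧ cd (f (s 1)) (f (s 2)) = d2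

lemma gamma0 {V : Type} [Fintype V] {G : SimpleGraph V} (hG : Critical52 G) {S : Finset V}
    {f : V → Fin 5} {K : SimpleGraph (V ⊕ Fin 5)} (hNL : NL G S f K) {E : SimpleGraph (Fin 10)}
    {σ : Fin 10 → V ⊕ Fin 5} (hσ : IsCopy K E σ) (hE : ∀ a, ∃ b, E.Adj a b)
    (B : Fin 10 → Bool) (hB : ∀ a, (σ a).isRight = B a) (yt xt : Fin 3 → Fin 10)
    (h1 : ∀ k, E.Adj (yt k) (xt k)) (h2 : ∀ k, B (yt k) = false) (h3 : ∀ k, B (xt k) = true)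
    (hcross : ∀ a b, E.Adj a b → B a = false → B b = true → ∃ k, a = yt k ∧ b = xt k)
    (d0 d1 d2 : Fin 5) (hd : d0 ≠ 0 ∧ d1 ≠ 0 ∧ d2 ≠ 0)
    (hext : ∀ κ : Fin 3 → Fin 5,
      (∃ hh : Fin 10 → Fin 5, (∀ a b, E.Adj a b → B a = false → B b = false → A5 (hh a) (hh b)) ∧
        ∀ k, A5 (hh (yt k)) (κ k)) ∨
      (cd (κ 0) (κ 1) = d0 ∧ cd (κ 0) (κ 2) = d1 ∧ cd (κ 1) (κ 2) = d2)) : Rigid G S := by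
  have hsup := hσ.support hE
  have hl : ∀ a, B a = false → ∃ y, y ∉ S ∧ σ a = .inl y := by
    intro a ha
    rw [← hB] at ha
    rcases hs : σ a with y | i
    · refine ⟨y, ?_, rfl⟩
      rw [← hNL.nS, ← hs, hsup]; exact ⟨a, rfl⟩
    · rw [hs] at ha; simp at ha
  have hr : ∀ a, B a = true → ∃ i, σ a = .inr i := by
    intro a ha
    rw [← hB] at ha
    rcases hs : σ a with y | i
    · rw [hs] at ha; simp at ha
    · exact ⟨i, rfl⟩
  have hs : ∀ k, ∃ s ∈ S, ∃ y, y ∉ S ∧ σ (yt k) = .inl y ∧ σ (xt k) = .inr (f s) ∧ G.Adj y s := by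
    intro k
    obtain ⟨y, hy, hy'⟩ := hl _ (h2 k)
    obtain ⟨i, hi⟩ := hr _ (h3 k)
    have := (hσ.adj _ _).2 (h1 k)
    rw [hy', hi] at this
    obtain ⟨s, hs, hsi, hys⟩ := (hNL.yx y hy i).1 this
    exact ⟨s, hs, y, hy, hy', by rw [hsi, hi], hys⟩
  choose s hsS y hyS hσy hσx hadj using hs
  have hι : ∀ v, ∃ a, v ∉ S → σ a = .inl v := by
    intro v
    by_cases hv : v ∈ S
    · exact ⟨0, fun h => (h hv).elim⟩
    · have := (hNL.nS v).2 hv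
      rw [hsup] at this
      obtain ⟨a, ha⟩ := this
      exact ⟨a, fun _ => ha⟩
  choose ι hι using hι
  have hιB : ∀ v, v ∉ S → B (ι v) = false := by
    intro v hv; rw [← hB, hι v hv]; rfl
  have hcr : ∀ v, v ∉ S → ∀ t ∈ S, G.Adj v t → ∃ k, ι v = yt k ∧ t = s k := by
    intro v hv t ht hvt
    have hk := (hNL.yx v hv (f t)).2 ⟨t, ht, rfl, hvt⟩
    have : Sum.inr (f t) ∈ K.support := ⟨_, hk.symm⟩
    rw [hsup] at this
    obtain ⟨b, hb⟩ := this
    rw [← hι v hv, ← hb, hσ.adj] at hk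
    obtain ⟨k, hk1, hk2⟩ := hcross _ _ hk (hιB v hv) (by rw [← hB, hb]; rfl)
    refine ⟨k, hk1, ?_⟩
    have e1 : y k = v := by
      have := hσy k; rw [← hk1, hι v hv] at this; simpa using this.symm
    have e2 : f t = f (s k) := by
      have := hσx k; rw [← hk2, hb] at this; simpa using this
    refine hNL.inj v hv t ht (s k) (hsS k) hvt ?_ e2
    rw [← e1]; exact hadj k
  refine ⟨s, hsS, ?_, d0, d1, d2, hd.1, hd.2.1, hd.2.2, ?_⟩
  · rintro t ⟨ht, v, hv, hvt⟩
    obtain ⟨k, -, hk⟩ := hcr v hv t ht hvt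
    exact ⟨k, hk⟩
  · intro g hg
    rcases hext (fun k => g (s k)) with ⟨hh, hh1, hh2⟩ | h
    · exfalso
      apply not_col hG (fun v => if v ∈ S then g v else hh (ι v))
      intro a b hab
      by_cases ha : a ∈ S <;> by_cases hb : b ∈ S <;> simp only [ha, hb, if_true, if_false]
      · exact hg a ha b hb hab
      · obtain ⟨k, e1, e2⟩ := hcr b hb a ha hab.symm
        rw [e1, e2]; exact A5_symm (hh2 k)
      · obtain ⟨k, e1, e2⟩ := hcr a ha b hb hab
        rw [e1, e2]; exact hh2 k
      · refine hh1 _ _ ?_ (hιB a ha) (hιB b hb)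
        rw [← hσ.adj, hι a ha, hι b hb, hNL.yy a ha b hb]; exact hab
    · exact h

lemma IsCopy.comp {W : Type} {n : ℕ} {K : SimpleGraph W} {E : SimpleGraph (Fin n)}
    {σ : Fin n → W} (h : IsCopy K E σ) (r : Fin n → Fin n) (hr : Function.Bijective r)
    (ha : ∀ a b, E.Adj (r a) (r b) ↔ E.Adj a b) : IsCopy K E (σ ∘ r) := by
  refine ⟨h.1.comp hr.1, ?_⟩
  intro x y
  rw [h.2]
  constructor
  · rintro ⟨a, b, h1, h2, h3⟩
    obtain ⟨a, rfl⟩ := hr.2 a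
    obtain ⟨b, rfl⟩ := hr.2 b
    exact ⟨a, b, (ha _ _).1 h1, h2, h3⟩
  · rintro ⟨a, b, h1, h2, h3⟩
    exact ⟨r a, r b, (ha _ _).2 h1, h2, h3⟩

/-- Rotations of `E1`. -/
def r1 (k : Fin 3) (a : Fin 10) : Fin 10 :=
  if a = 9 then 9 else Fin.ofNat 10 ((a.val + 3 * k.val) % 9)

/-- Symmetries of `E2`. -/
def r2 (k : Fin 2) (a : Fin 10) : Fin 10 :=
  if k = 0 then a else ![0, 1, 5, 6, 7, 2, 3, 4, 9, 8] a

/-- The standard 5-cycle of `E1`. -/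
def B1 (a : Fin 10) : Bool := a.val ≤ 3 || a.val == 9

/-- The standard 5-cycle of `E2`. -/
def B2 (a : Fin 10) : Bool := a.val ≤ 4

lemma r1_bij : ∀ k, Function.Injective (r1 k) := by unfold Function.Injective; decide +kernel
lemma r2_bij : ∀ k, Function.Injective (r2 k) := by unfold Function.Injective; decide +kernel
lemma r1_adj (k) : ∀ a b, E1.Adj (r1 k a) (r1 k b) ↔ E1.Adj a b := by
  simp only [E1_adj]; revert k; decide +kernel
lemma r2_adj (k) : ∀ a b, E2.Adj (r2 k a) (r2 k b) ↔ E2.Adj a b := by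
  simp only [E2_adj]; revert k; decide +kernel

lemma cyc1 : ∀ p0 p1 : Fin 10, ladj L1 p0 p1 = true → ∀ p2 : Fin 10, ladj L1 p1 p2 = true →
    ∀ p3 : Fin 10, ladj L1 p2 p3 = true → ∀ p4 : Fin 10, ladj L1 p3 p4 = true → ladj L1 p4 p0 = true →
    ∃ k, ∀ a, B1 a = true → (r1 k a = p0 ∨ r1 k a = p1 ∨ r1 k a = p2 ∨ r1 k a = p3 ∨ r1 k a = p4) := by
  decide +kernel

lemma cyc2 : ∀ p0 p1 : Fin 10, ladj L2 p0 p1 = true → ∀ p2 : Fin 10, ladj L2 p1 p2 = true →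
    ∀ p3 : Fin 10, ladj L2 p2 p3 = true → ∀ p4 : Fin 10, ladj L2 p3 p4 = true → ladj L2 p4 p0 = true →
    ∃ k, ∀ a, B2 a = true → (r2 k a = p0 ∨ r2 k a = p1 ∨ r2 k a = p2 ∨ r2 k a = p3 ∨ r2 k a = p4) := by
  decide +kernel

lemma cr1 : ∀ a b : Fin 10, ladj L1 a b = true → B1 a = false → B1 b = true →
   ∃ k : Fin 3, a = (![4, 6, 8] : Fin 3 → Fin 10) k ∧ b = (![3, 9, 0] : Fin 3 → Fin 10) k := by decide +kernel

lemma cr2 : ∀ a b : Fin 10, ladj L2 a b = true → B2 a = false → B2 b = true →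
   ∃ k : Fin 3, a = (![5, 7, 8] : Fin 3 → Fin 10) k ∧ b = (![1, 0, 3] : Fin 3 → Fin 10) k := by decide +kernel

lemma in1 : ∀ a b : Fin 10, ladj L1 a b = true → B1 a = false → B1 b = false →
   (a = 4 ∧ b = 5) ∨ (a = 5 ∧ b = 4) ∨ (a = 5 ∧ b = 6) ∨ (a = 6 ∧ b = 5) ∨
   (a = 6 ∧ b = 7) ∨ (a = 7 ∧ b = 6) ∨ (a = 7 ∧ b = 8) ∨ (a = 8 ∧ b = 7) := by decide +kernel

lemma in2 : ∀ a b : Fin 10, ladj L2 a b = true → B2 a = false → B2 b = false →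
   (a = 5 ∧ b = 6) ∨ (a = 6 ∧ b = 5) ∨ (a = 6 ∧ b = 7) ∨ (a = 7 ∧ b = 6) ∨
   (a = 6 ∧ b = 9) ∨ (a = 9 ∧ b = 6) ∨ (a = 8 ∧ b = 9) ∨ (a = 9 ∧ b = 8) := by decide +kernel

/-- From a copy with all five colours, a closed 5-walk. -/
lemma copy_walk {V : Type} [Fintype V] {G : SimpleGraph V} {S : Finset V}
    {f : V → Fin 5} {K : SimpleGraph (V ⊕ Fin 5)} (hNL : NL G S f K) (hX : (Xf K).card = 5)
    {E : SimpleGraph (Fin 10)}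
    {σ : Fin 10 → V ⊕ Fin 5} (hσ : IsCopy K E σ) (hE : ∀ a, ∃ b, E.Adj a b) :
    ∃ p : Fin 5 → Fin 10, (∀ i, σ (p i) = .inr i) ∧ ∀ i j, A5 i j → E.Adj (p i) (p j) := by
  have hu : Xf K = Finset.univ := by
    apply Finset.eq_univ_of_card; simpa using hX
  have hm : ∀ i, i ∈ Xf K := by simp [hu]
  have : ∀ i, ∃ a, σ a = .inr i := by
    intro i
    have := mem_Xf.1 (hm i)
    rw [hσ.support hE] at this
    exact this
  choose p hp using this
  refine ⟨p, hp, ?_⟩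
  intro i j hij
  rw [← hσ.adj, hp, hp, hNL.xx i (hm i) j (hm j)]
  exact hij

/-- Exactly the marked vertices are sent to colours. -/
lemma copy_B {V : Type} {σ : Fin 10 → V ⊕ Fin 5} (hσ : Function.Injective σ) {B : Fin 10 → Bool}
    (hc : (Finset.univ.filter (fun a => B a = true)).card = 5)
    (h : ∀ a, B a = true → (σ a).isRight = true) (a : Fin 10) : (σ a).isRight = B a := by
  cases hB : B a with
  | true => exact h a hB
  | false =>
    by_contra hcon
    have hcon : (σ a).isRight = true := by simpa using hcon
    have h6 : (insert a (Finset.univ.filter (fun a => B a = true))).card = 6 := by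
      rw [Finset.card_insert_of_notMem (by simp [hB]), hc]
    have hall : ∀ b ∈ insert a (Finset.univ.filter (fun a => B a = true)), ∃ i, σ b = .inr i := by
      intro b hb
      have : (σ b).isRight = true := by
        simp at hb
        rcases hb with rfl | hb
        · exact hcon
        · exact h b hb
      rcases hs : σ b with y | i
      · rw [hs] at this; simp at this
      · exact ⟨i, rfl⟩
    choose! q hq using hall
    have := Finset.card_le_card_of_injOn (t := (Finset.univ : Finset (Fin 5))) q (by simp) (s := insert a (Finset.univ.filter (fun a => B a = true))) (by
      intro b hb c hc hbc
      apply hσ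
      rw [hq b hb, hq c hc, hbc])
    rw [h6] at this
    simp at this

lemma gamma {V : Type} [Fintype V] {G : SimpleGraph V} (hG : SmallestCex G) {S : Finset V}
    (hS : S.Nonempty) (hu : S ≠ Finset.univ)
    (hi : 6 ≤ S.card) (hP : PP G S ≤ 5) (hc : Sᶜ.card = 5) : Rigid G S := by
  obtain ⟨f, hf⟩ := exists_colOn hG.1 S hu
  obtain ⟨K, hNL, h⟩ := struct0 hG hS hu hf (img_lt hi f) hP
  have hX : (Xf K).card = 5 ∧ ((∃ σ, IsCopy K E1 σ) ∨ (∃ σ, IsCopy K E2 σ)) := by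
    rcases h with h | h | h | h
    · omega
    · omega
    · omega
    · exact ⟨h.2.1, h.1⟩
  obtain ⟨hX, ⟨σ, hσ⟩ | ⟨σ, hσ⟩⟩ := hX
  · obtain ⟨p, hp, hw⟩ := copy_walk hNL hX hσ noiso_E1
    obtain ⟨k, hk⟩ := cyc1 (p 0) (p 1) ((E1_adj _ _).1 (hw 0 1 (by decide)))
      (p 2) ((E1_adj _ _).1 (hw 1 2 (by decide))) (p 3) ((E1_adj _ _).1 (hw 2 3 (by decide)))
      (p 4) ((E1_adj _ _).1 (hw 3 4 (by decide))) ((E1_adj _ _).1 (hw 4 0 (by decide)))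
    have hσ' := hσ.comp (r1 k) (Finite.injective_iff_bijective.1 (r1_bij k)) (r1_adj k)
    refine gamma0 hG.1 hNL hσ' noiso_E1 B1 (copy_B hσ'.1 (by decide +kernel) ?_) ![4, 6, 8] ![3, 9, 0]
      (by simp only [E1_adj]; decide +kernel) (by decide +kernel) (by decide +kernel)
      (by simp only [E1_adj]; exact cr1) 1 4 1 (by decide) ?_
    · intro a ha
      rcases hk a ha with h | h | h | h | h <;> simp [h, hp]
    · intro κ
      rcases ext1 (κ 0) (κ 1) (κ 2) with ⟨a, h1, b, h2, c, h3, h4, d, h5, e, h6, h7⟩ | h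
      · refine Or.inl ⟨![0, 0, 0, 0, a, b, c, d, e, 0], ?_, ?_⟩
        · simp only [E1_adj]
          intro x y hxy hx hy
          rcases in1 x y hxy hx hy with ⟨rfl, rfl⟩ | ⟨rfl, rfl⟩ | ⟨rfl, rfl⟩ | ⟨rfl, rfl⟩ | ⟨rfl, rfl⟩ | ⟨rfl, rfl⟩ | ⟨rfl, rfl⟩ | ⟨rfl, rfl⟩
          exacts [h2, A5_symm h2, h3, A5_symm h3, h5, A5_symm h5, h6, A5_symm h6]
        · intro k
          fin_cases k
          exacts [h1, h4, h7]
      · exact Or.inr h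
  · obtain ⟨p, hp, hw⟩ := copy_walk hNL hX hσ noiso_E2
    obtain ⟨k, hk⟩ := cyc2 (p 0) (p 1) ((E2_adj _ _).1 (hw 0 1 (by decide)))
      (p 2) ((E2_adj _ _).1 (hw 1 2 (by decide))) (p 3) ((E2_adj _ _).1 (hw 2 3 (by decide)))
      (p 4) ((E2_adj _ _).1 (hw 3 4 (by decide))) ((E2_adj _ _).1 (hw 4 0 (by decide)))
    have hσ' := hσ.comp (r2 k) (Finite.injective_iff_bijective.1 (r2_bij k)) (r2_adj k)
    refine gamma0 hG.1 hNL hσ' noiso_E2 B2 (copy_B hσ'.1 (by decide +kernel) ?_) ![5, 7, 8] ![1, 0, 3]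
      (by simp only [E2_adj]; decide +kernel) (by decide +kernel) (by decide +kernel)
      (by simp only [E2_adj]; exact cr2) 1 4 4 (by decide) ?_
    · intro a ha
      rcases hk a ha with h | h | h | h | h <;> simp [h, hp]
    · intro κ
      rcases ext2 (κ 0) (κ 1) (κ 2) with ⟨a, h1, b, h2, c, h3, h4, d, h5, e, h6, h7⟩ | h
      · refine Or.inl ⟨![0, 0, 0, 0, 0, a, b, c, e, d], ?_, ?_⟩
        · simp only [E2_adj]
          intro x y hxy hx hy
          rcases in2 x y hxy hx hy with ⟨rfl, rfl⟩ | ⟨rfl, rfl⟩ | ⟨rfl, rfl⟩ | ⟨rfl, rfl⟩ | ⟨rfl, rfl⟩ | ⟨rfl, rfl⟩ | ⟨rfl, rfl⟩ | ⟨rfl, rfl⟩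
          exacts [h2, A5_symm h2, h3, A5_symm h3, h5, A5_symm h5, A5_symm h6, h6]
        · intro k
          fin_cases k
          exacts [h1, h4, h7]
      · exact Or.inr h

end

section
open Classical

/-- The model `M` on `{0, …, n-1}` embeds in `G` via `φ`. -/
structure Emb {V : Type} (G : SimpleGraph V) (n : ℕ) (M : ℕ → ℕ → Bool) (φ : ℕ → V) : Prop where
  inj : ∀ a < n, ∀ b < n, φ a = φ b → a = b
  adj : ∀ a < n, ∀ b < n, M a b = true → G.Adj (φ a) (φ b)

/-- Image of the model. -/
noncomputable def im {V : Type} (n : ℕ) (φ : ℕ → V) : Finset V := (Finset.range n).image φ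

lemma mem_im {V : Type} {n : ℕ} {φ : ℕ → V} {x : V} : x ∈ im n φ ↔ ∃ a < n, φ a = x := by
  simp [im]

/-- Number of darts of a model. -/
def cnt (n : ℕ) (M : ℕ → ℕ → Bool) : ℕ :=
  ((Finset.range n ×ˢ Finset.range n).filter (fun p => M p.1 p.2 = true)).card

/-- `G` on the image is exactly the model. -/
def Exact {V : Type} (G : SimpleGraph V) (n : ℕ) (M : ℕ → ℕ → Bool) (φ : ℕ → V) : Prop :=
  ∀ a < n, ∀ b < n, G.Adj (φ a) (φ b) → M a b = true

lemma Emb.card {V : Type} {G : SimpleGraph V} {n : ℕ} {M : ℕ → ℕ → Bool} {φ : ℕ → V}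
    (h : Emb G n M φ) : (im n φ).card = n := by
  unfold im
  rw [Finset.card_image_of_injOn]
  · simp
  · intro a ha b hb hab
    exact h.inj a (by simpa using ha) b (by simpa using hb) hab

lemma Emb.ee {V : Type} {G : SimpleGraph V} {n : ℕ} {M : ℕ → ℕ → Bool} {φ : ℕ → V}
    (h : Emb G n M φ) : ∃ l, ee G (im n φ) (im n φ) = cnt n M + l ∧ (l = 0 → Exact G n M φ) := by
  let P := ((Finset.range n ×ˢ Finset.range n).filter (fun p => M p.1 p.2 = true))
  let Q := ((Finset.range n ×ˢ Finset.range n).filter (fun p => G.Adj (φ p.1) (φ p.2)))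
  have hPQ : P ⊆ Q := by
    rintro ⟨a, b⟩ hab
    simp only [P, Q, Finset.mem_filter, Finset.mem_product, Finset.mem_range] at hab ⊢
    exact ⟨hab.1, h.adj a hab.1.1 b hab.1.2 hab.2⟩
  have hQ : _root_.ee G (im n φ) (im n φ) = Q.card := by
    unfold _root_.ee
    symm
    refine Finset.card_bij (fun p _ => (φ p.1, φ p.2)) ?_ ?_ ?_
    · rintro ⟨a, b⟩ hab
      simp only [Q, Finset.mem_filter, Finset.mem_product, Finset.mem_range, mem_im] at hab ⊢
      exact ⟨⟨⟨a, hab.1.1, rfl⟩, ⟨b, hab.1.2, rfl⟩⟩, hab.2⟩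
    · rintro ⟨a, b⟩ hab ⟨c, d⟩ hcd e
      simp only [Q, Finset.mem_filter, Finset.mem_product, Finset.mem_range, Prod.mk.injEq] at hab hcd e
      rw [h.inj a hab.1.1 c hcd.1.1 e.1, h.inj b hab.1.2 d hcd.1.2 e.2]
    · rintro ⟨x, y⟩ hxy
      simp only [Q, Finset.mem_filter, Finset.mem_product, Finset.mem_range, mem_im] at hxy ⊢
      obtain ⟨⟨⟨a, ha, rfl⟩, ⟨b, hb, rfl⟩⟩, h2⟩ := hxy
      exact ⟨(a, b), ⟨⟨ha, hb⟩, h2⟩, rfl⟩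
  have hle := Finset.card_le_card hPQ
  have hP : cnt n M = P.card := rfl
  refine ⟨Q.card - P.card, by omega, ?_⟩
  intro hl a ha b hb hab
  have := Finset.eq_of_subset_of_card_le hPQ (by omega)
  have hm : (a, b) ∈ Q := by simp [Q, ha, hb, hab]
  rw [← this] at hm
  simp only [P, Finset.mem_filter] at hm
  exact hm.2

lemma Emb.col {V : Type} {G : SimpleGraph V} {n : ℕ} {M : ℕ → ℕ → Bool} {φ : ℕ → V}
    (h : Emb G n M φ) (he : Exact G n M φ) (c : ℕ → Fin 5)
    (hc : ∀ a < n, ∀ b < n, M a b = true → A5 (c a) (c b)) :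
    ∃ f, ColOn G (im n φ) f ∧ ∀ a < n, f (φ a) = c a := by
  have : ∀ v, ∃ a, v ∈ im n φ → a < n ∧ φ a = v := by
    intro v
    by_cases hv : v ∈ im n φ
    · obtain ⟨a, ha⟩ := mem_im.1 hv
      exact ⟨a, fun _ => ha⟩
    · exact ⟨0, fun h => (hv h).elim⟩
  choose ι hι using this
  refine ⟨fun v => c (ι v), ?_, ?_⟩
  · intro x hx y hy hxy
    obtain ⟨h1, h2⟩ := hι x hx
    obtain ⟨h3, h4⟩ := hι y hy
    refine hc _ h1 _ h3 (he _ h1 _ h3 ?_)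
    rw [h2, h4]; exact hxy
  · intro a ha
    obtain ⟨h1, h2⟩ := hι (φ a) (mem_im.2 ⟨a, ha, rfl⟩)
    dsimp only; rw [h.inj _ h1 _ ha h2]

lemma Emb.univ_false {V : Type} [Fintype V] {G : SimpleGraph V} (hG : Critical52 G)
    {n : ℕ} {M : ℕ → ℕ → Bool} {φ : ℕ → V}
    (h : Emb G n M φ) (he : Exact G n M φ) (c : ℕ → Fin 5)
    (hc : ∀ a < n, ∀ b < n, M a b = true → A5 (c a) (c b)) (hu : im n φ = Finset.univ) : False := by
  obtain ⟨f, hf, -⟩ := h.col he c hc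
  rw [hu] at hf
  exact not_col hG f (fun a b hab => hf a (by simp) b (by simp) hab)

lemma iso_of {V : Type} {G : SimpleGraph V} {n : ℕ} {E : SimpleGraph (Fin n)} (φ : Fin n → V)
    (hφ : Function.Bijective φ) (π : Fin n → Fin n) (hπ : Function.Injective π)
    (h : ∀ a b, G.Adj (φ a) (φ b) ↔ E.Adj (π a) (π b)) : Nonempty (G ≃g E) := by
  let e1 := Equiv.ofBijective φ hφ
  let e2 := Equiv.ofBijective π (Finite.injective_iff_bijective.1 hπ)
  refine ⟨⟨e1.symm.trans e2, ?_⟩⟩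
  intro x y
  obtain ⟨a, rfl⟩ := e1.surjective x
  obtain ⟨b, rfl⟩ := e1.surjective y
  simp only [Equiv.trans_apply, Equiv.symm_apply_apply]
  exact (h a b).symm

lemma noTri {V : Type} [Fintype V] {G : SimpleGraph V} (hG : SmallestCex G) {a b c : V}
    (hab : G.Adj a b) (hbc : G.Adj b c) (hca : G.Adj c a) : False := by
  by_cases hu : ({a, b, c} : Finset V) = Finset.univ
  · have hm : ∀ x, x = a ∨ x = b ∨ x = c := by
      intro x
      have : x ∈ ({a, b, c} : Finset V) := by rw [hu]; simp
      simpa using this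
    refine hG.2.1.false (Classical.choice (iso_of ![a, b, c] ⟨?_, ?_⟩ id Function.injective_id ?_))
    · have h1 := hab.ne
      have h2 := hbc.ne
      have h3 := hca.ne
      intro x y hxy
      fin_cases x <;> fin_cases y <;> simp_all
    · intro x
      rcases hm x with rfl | rfl | rfl
      exacts [⟨0, rfl⟩, ⟨1, rfl⟩, ⟨2, rfl⟩]
    · intro x y
      rw [C3_adj]
      fin_cases x <;> fin_cases y <;> simp [hab, hbc, hca, hab.symm, hbc.symm, hca.symm]
  · obtain ⟨f, hf⟩ := exists_colOn hG.1 _ hu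
    have h1 := hf a (by simp) b (by simp) hab
    have h2 := hf b (by simp) c (by simp) hbc
    have h3 := hf c (by simp) a (by simp) hca
    have key : ∀ x y z : Fin 5, A5 x y → A5 y z → A5 z x → False := by decide
    exact key _ _ _ h1 h2 h3

lemma noSq {V : Type} [Fintype V] {G : SimpleGraph V} (hG : SmallestCex G) {a b c d : V}
    (hab : G.Adj a b) (hbc : G.Adj b c) (hcd : G.Adj c d) (hda : G.Adj d a)
    (hac : a ≠ c) (hbd : b ≠ d) : False := by
  have nac : ¬ G.Adj a c := fun h => noTri hG hab hbc h.symm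
  have nbd : ¬ G.Adj b d := fun h => noTri hG hbc hcd h.symm
  have nca : ¬ G.Adj c a := fun h => nac h.symm
  have ndb : ¬ G.Adj d b := fun h => nbd h.symm
  have h1 := hab.ne
  have h2 := hbc.ne
  have h3 := hcd.ne
  have h4 := hda.ne
  let S : Finset V := {a, b, c, d}
  have mS : ∀ x, x ∈ S ↔ x = a ∨ x = b ∨ x = c ∨ x = d := by intro x; simp [S]
  have hScard : S.card = 4 := by
    simp only [S]
    rw [Finset.card_insert_of_notMem (by simp; tauto), Finset.card_insert_of_notMem (by simp; tauto),
      Finset.card_insert_of_notMem (by simp; tauto), Finset.card_singleton]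
  have hcol : ∀ x y z w : Fin 5, A5 x y → A5 y z → A5 z w → A5 w x →
      ∃ f, ColOn G S f ∧ f a = x ∧ f b = y ∧ f c = z ∧ f d = w := by
    intro x y z w hxy hyz hzw hwx
    have fa : (fun v => if v = a then x else if v = b then y else if v = c then z else w) a = x := by simp
    have fb : (fun v => if v = a then x else if v = b then y else if v = c then z else w) b = y := by
      simp [h1.symm]
    have fc : (fun v => if v = a then x else if v = b then y else if v = c then z else w) c = z := by
      simp [h2.symm, hac.symm]
    have fd : (fun v => if v = a then x else if v = b then y else if v = c then z else w) d = w := by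
      simp [h4, hbd.symm, h3.symm]
    generalize (fun v => if v = a then x else if v = b then y else if v = c then z else w) = f at *
    refine ⟨f, ?_, fa, fb, fc, fd⟩
    intro p hp q hq hpq
    rw [mS] at hp hq
    rcases hp with rfl | rfl | rfl | rfl <;> rcases hq with rfl | rfl | rfl | rfl <;>
      first
      | exact (G.loopless.irrefl _ hpq).elim
      | exact (nac hpq).elim
      | exact (nbd hpq).elim
      | exact (nca hpq).elim
      | exact (ndb hpq).elim
      | (simp only [fa, fb, fc, fd]; first | assumption | (apply A5_symm; assumption))
  have hu : S ≠ Finset.univ := by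
    intro hu
    obtain ⟨f, hf, -⟩ := hcol 0 1 0 1 (by decide) (by decide) (by decide) (by decide)
    rw [hu] at hf
    exact not_col hG.1 f (fun a b hab => hf a (by simp) b (by simp) hab)
  have hS : S.Nonempty := ⟨a, by simp [S]⟩
  have hee : 8 ≤ ee G S S := by
    have : ({(a, b), (b, a), (b, c), (c, b), (c, d), (d, c), (d, a), (a, d)} : Finset (V × V)).card = 8 := by
      rw [Finset.card_insert_of_notMem, Finset.card_insert_of_notMem, Finset.card_insert_of_notMem,
        Finset.card_insert_of_notMem, Finset.card_insert_of_notMem, Finset.card_insert_of_notMem,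
        Finset.card_insert_of_notMem, Finset.card_singleton] <;> simp <;> tauto
    rw [← this]
    unfold ee
    apply Finset.card_le_card
    intro p hp
    simp only [Finset.mem_insert, Finset.mem_singleton] at hp
    simp only [Finset.mem_filter, Finset.mem_product, mS]
    rcases hp with rfl | rfl | rfl | rfl | rfl | rfl | rfl | rfl <;>
      simp [hab, hbc, hcd, hda, hab.symm, hbc.symm, hcd.symm, hda.symm]
  have hPP : PP G S ≤ 4 := by unfold PP; omega
  have hi : ∀ f, ColOn G S f → (S.image f).card < S.card := by
    intro f hf
    refine lt_of_le_of_ne Finset.card_image_le ?_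
    intro he
    have hinj := Finset.card_image_iff.1 he
    have key : ∀ x y z w : Fin 5, A5 x y → A5 y z → A5 z w → A5 w x → x = z ∨ y = w := by
      decide +kernel
    rcases key _ _ _ _ (hf a (by simp [S]) b (by simp [S]) hab) (hf b (by simp [S]) c (by simp [S]) hbc)
      (hf c (by simp [S]) d (by simp [S]) hcd) (hf d (by simp [S]) a (by simp [S]) hda) with h | h
    · exact hac (hinj (by simp [S]) (by simp [S]) h)
    · exact hbd (hinj (by simp [S]) (by simp [S]) h)
  obtain ⟨f1, hf1, q1, q2, q3, q4⟩ := hcol 0 1 0 4 (by decide) (by decide) (by decide) (by decide)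
  obtain ⟨f2, hf2, p1, p2, p3, p4⟩ := hcol 1 0 4 0 (by decide) (by decide) (by decide) (by decide)
  have hc2 : Sᶜ.card = 2 := by
    obtain ⟨K, hNL, h⟩ := struct0 hG hS hu hf1 (hi _ hf1) (by omega)
    omega
  obtain ⟨y1, y2, u, v, hy, hm, hy12, huS, hvS, hu1, hv1⟩ :=
    alpha2 hG hS hu hf1 (hi _ hf1) (by omega) hc2
  have hy1u := (hu1 u huS).2 rfl
  have hy2v := (hv1 v hvS).2 rfl
  have hAu : inA G S u := ⟨huS, y1, (hm _).2 (Or.inl rfl), hy1u⟩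
  have hAv : inA G S v := ⟨hvS, y2, (hm _).2 (Or.inr rfl), hy2v⟩
  have e1 := A_const hG hS hu hf1 (hi _ hf1) (by omega) (Or.inl hc2) hAu hAv
  have e2 := A_const hG hS hu hf2 (hi _ hf2) (by omega) (Or.inl hc2) hAu hAv
  have huv : u = v := by
    rw [mS] at huS hvS
    rcases huS with rfl | rfl | rfl | rfl <;> rcases hvS with rfl | rfl | rfl | rfl <;>
      first
      | rfl
      | (exfalso; simp only [p1, p2, p3, p4, q1, q2, q3, q4] at e1 e2; revert e1 e2; decide)
  subst huv
  exact noTri hG hy12 hy2v hy1u.symm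

end

/-- Oriented edges of the model: a `k`-cycle `0 … k-1` and a path with `r` inner vertices
`k, …, k+r-1` from `0` to `j`. -/
def medge (k r j a b : ℕ) : Bool :=
  (Nat.beq (a + 1) b && Nat.blt b k) || (Nat.beq a 0 && Nat.beq (b + 1) k) ||
  (match r with
  | 0 => Nat.beq a 0 && Nat.beq b j
  | _ + 1 => (Nat.beq a 0 && Nat.beq b k) || (Nat.ble k a && Nat.beq (a + 1) b && Nat.blt b (k + r)) ||
      (Nat.beq a j && Nat.beq (b + 1) (k + r)))

/-- Adjacency in the model. -/
def madj (k r j a b : ℕ) : Bool := medge k r j a b || medge k r j b a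

/-- Boolean adjacency in the 5-cycle. -/
def a5b (x y : Fin 5) : Bool :=
  Nat.beq x.val ((y.val + 1) % 5) || Nat.beq y.val ((x.val + 1) % 5)

lemma a5b_iff (x y : Fin 5) : a5b x y = true ↔ A5 x y := by revert x y; decide +kernel

/-- No triangles or 4-cycles. -/
def nshort (n : ℕ) (M : ℕ → ℕ → Bool) : Bool :=
  (List.range n).all fun a => (List.range n).all fun b => !M a b || (List.range n).all fun c =>
    !M b c || Nat.beq a c || (!M c a && (List.range n).all fun d => !M c d || !M d a || Nat.beq b d)

/-- Colour of vertex `a` in the colouring encoded by `l` in base 5. -/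
def cl (l a : ℕ) : Fin 5 := Fin.ofNat 5 (l / 5 ^ a)

/-- Validity of a colouring. -/
def cvalid (n : ℕ) (M : ℕ → ℕ → Bool) (l : ℕ) : Bool :=
  (List.range n).all fun a => (List.range n).all fun b => !M a b || a5b (cl l a) (cl l b)

/-- Sample colourings, for the model with parameters `k r j` encoded as `100 k + 10 r + j`. -/
def ctab : List (ℕ × List ℕ) :=
  [(522, [62305]), (523, [37305]), (531, [218555]),
   (532, [84180, 271680, 93555]), (533, [318555, 218555, 327930]), (534, [271680]),
   (540, [1834180, 609180]), (541, [84180, 1052930, 374805, 874805]), (542, [1490430, 609180, 1546680]),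
   (543, [865430, 1834180, 874805, 896680]), (544, [84180, 1390430, 1490430, 115430]), (613, [67305]),
   (622, [300180, 301680, 309555]), (623, [18880, 300505, 30505, 75180, 176680]), (624, [301380, 301680, 186755]),
   (631, [1081380, 1093005, 1082930, 1090805]), (632, [409505, 1863880, 1356430, 457930, 421130]), (633, [1081380, 1629805, 1358630, 1090805, 1082930]),
   (634, [409505, 1862680, 1593005, 1348555, 418930]), (635, [1081380, 1356430, 1082930, 1358630]), (713, [386055, 331055, 377930]),
   (714, [151380, 151680, 336755]), (722, [1557680, 1502930, 1559180]), (723, [151380, 924805, 1508630, 385805, 932930]),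
   (724, [1557630, 1502930, 152930, 1557680]), (725, [932630, 934180, 1508630, 932680]), (804, [121680]),
   (813, [1645430, 1684180, 1879805, 1676680]), (814, [472005, 762680, 1930505, 707930, 1643930]), (815, [1682630, 1684180, 758630, 1682680]),
   (904, [409180, 1840430, 465430, 565430]), (905, [1831380, 606430, 1832930, 608630])]

/-- Sample colourings of the model. -/
def cols (k r j : ℕ) : List ℕ :=
  match ctab.find? fun p => p.1 == 100 * k + 10 * r + j with
  | some p => p.2
  | none => []

/-- Extension of a model by a list of edges. -/
def mext (n : ℕ) (M : ℕ → ℕ → Bool) (X : List (ℕ × ℕ)) (a b : ℕ) : Bool :=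
  (Nat.blt a n && Nat.blt b n && M a b) || ladj X a b

/-- Candidate isomorphisms to `E1`. -/
def perms1 : List (List ℕ) :=
  [[6, 9, 3, 4, 5, 7, 8, 0, 2, 1],
   [0, 9, 3, 2, 1, 8, 7, 6, 5, 4],
   [9, 0, 8, 7, 6, 3, 2, 1, 5, 4],
   [9, 0, 1, 2, 3, 6, 7, 8, 5, 4],
   [9, 3, 2, 1, 0, 6, 7, 8, 4, 5],
   [9, 0, 1, 2, 3, 6, 5, 4, 7, 8],
   [0, 1, 2, 3, 9, 8, 7, 6, 4, 5],
   [3, 2, 1, 0, 9, 4, 5, 6, 7, 8],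
   [9, 3, 2, 1, 0, 8, 7, 6, 4, 5],
   [9, 0, 8, 7, 6, 5, 4, 3, 2, 1],
   [0, 8, 7, 6, 9, 3, 2, 1, 5, 4],
   [6, 5, 4, 3, 9, 0, 8, 7, 1, 2]]

/-- Candidate isomorphisms to `E2`. -/
def perms2 : List (List ℕ) :=
  [[3, 4, 0, 1, 2, 8, 9, 6, 7, 5],
   [1, 5, 6, 7, 0, 2, 3, 8, 9, 4],
   [1, 0, 7, 6, 5, 2, 3, 8, 9, 4],
   [6, 7, 0, 1, 5, 9, 8, 3, 2, 4],
   [3, 4, 0, 7, 6, 9, 8, 2, 1, 5],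
   [0, 4, 3, 8, 9, 6, 7, 1, 2, 5],
   [1, 5, 6, 9, 8, 3, 2, 0, 4, 7],
   [6, 9, 8, 3, 2, 1, 5, 7, 0, 4],
   [1, 0, 4, 3, 8, 9, 6, 5, 2, 7],
   [3, 4, 0, 1, 5, 6, 9, 8, 2, 7],
   [1, 5, 6, 9, 8, 3, 4, 0, 2, 7],
   [3, 8, 9, 6, 7, 0, 1, 2, 4, 5],
   [1, 0, 7, 6, 5, 2, 3, 4, 9, 8],
   [0, 1, 2, 3, 4, 7, 6, 5, 9, 8],
   [0, 4, 3, 2, 1, 7, 6, 5, 8, 9],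
   [0, 4, 3, 2, 1, 7, 6, 5, 9, 8],
   [1, 2, 3, 4, 0, 7, 6, 5, 8, 9],
   [1, 2, 3, 4, 0, 7, 6, 5, 9, 8]]

/-- Check of an isomorphism. -/
def isoChk (L : List (ℕ × ℕ)) (M : ℕ → ℕ → Bool) (p : List ℕ) : Bool :=
  (List.range 10).all fun a => (List.range 10).all fun b => M a b == ladj L (p.getD a 0) (p.getD b 0)

/-- The model is a copy of one of the exceptional graphs. -/
def isoAny (M : ℕ → ℕ → Bool) : Bool := perms1.any (isoChk L1 M) || perms2.any (isoChk L2 M)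

/-- Rigid pairs. -/
def rig (Ls : List ℕ) (u v : ℕ) : Bool :=
  !(Nat.beq u v) && Ls.tail.all fun l =>
    Nat.beq (cd (cl l u) (cl l v)).val (cd (cl (Ls.headD 0) u) (cl (Ls.headD 0) v)).val

/-- Three vertices in a common 5-cycle. -/
def inC5 (n : ℕ) (M : ℕ → ℕ → Bool) (s0 s1 s2 : ℕ) : Bool :=
  (List.range n).any fun p1 => M s0 p1 && (List.range n).any fun p2 => M p1 p2 &&
    (List.range n).any fun p3 => M p2 p3 && (List.range n).any fun p4 => M p3 p4 && M p4 s0 &&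
    ([p1, p2, p3, p4].elem s1 && [p1, p2, p3, p4].elem s2)

/-- Separation of pairs. -/
def sepB (Ls : List ℕ) (u v : ℕ) : Bool := Ls.any fun l => !(cl l u == cl l v)

/-- Non-adjacency of colours. -/
def nadB (Ls : List ℕ) (u v : ℕ) : Bool := Ls.any fun l => !(a5b (cl l u) (cl l v))

/-- Checks for nine vertices. -/
def chk9 (M : ℕ → ℕ → Bool) (Ls : List ℕ) : Bool :=
  ((List.range 9).all fun u => (List.range 9).all fun v => Nat.beq u v ||
    (sepB Ls u v && (nadB Ls u v || M u v || isoAny (mext 9 M [(9, u), (9, v)])))) &&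
  ((List.range 9).all fun s0 => (List.range 9).all fun s1 => !rig Ls s0 s1 || (List.range 9).all fun s2 =>
    !(rig Ls s0 s2 && rig Ls s1 s2) || inC5 9 M s0 s1 s2)

/-- Checks for eight vertices. -/
def chk8 (M : ℕ → ℕ → Bool) (Ls : List ℕ) : Bool :=
  ((List.range 8).all fun u => (List.range 8).all fun v => Nat.beq u v || sepB Ls u v ||
    isoAny (mext 8 M [(8, 9), (8, u), (9, v)]))

/-- All checks. -/
def chk (n : ℕ) (M : ℕ → ℕ → Bool) (Ls : List ℕ) : Bool :=
  !Ls.isEmpty && Ls.all (cvalid n M) &&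
    (if n == 9 then chk9 M Ls else if n == 8 then chk8 M Ls else true)

/-- Nondegenerate parameters. -/
def good (k r j : ℕ) : Bool :=
  Nat.ble 5 k && Nat.blt j k &&
    (if r == 0 then !(j == 0) && !(j == 1) && !(j + 1 == k) else if r == 1 then !(j == 0) else true)

lemma cnt_all : ∀ k < 10, ∀ r < 10 - k, ∀ j < k, good k r j = true →
    nshort (k + r) (madj k r j) = true → cnt (k + r) (madj k r j) = 2 * (k + r + 1) := by
  decide +kernel

lemma chk_all : ∀ k < 10, ∀ r < 10 - k, ∀ j < k, good k r j = true →
    nshort (k + r) (madj k r j) = true → chk (k + r) (madj k r j) (cols k r j) = true := by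
  decide +kernel

lemma perms_ok : ∀ p ∈ perms1 ++ perms2, (∀ a < 10, p.getD a 0 < 10) ∧
    ∀ a < 10, ∀ b < 10, p.getD a 0 = p.getD b 0 → a = b := by decide +kernel

section
open Classical

lemma iso_false {V : Type} [Fintype V] {G : SimpleGraph V} (hG : SmallestCex G) (ψ : ℕ → V)
    (M' : ℕ → ℕ → Bool) (hinj : ∀ a < 10, ∀ b < 10, ψ a = ψ b → a = b)
    (hsurj : ∀ x, ∃ a < 10, ψ a = x)
    (hadj : ∀ a < 10, ∀ b < 10, (G.Adj (ψ a) (ψ b) ↔ M' a b = true))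
    (h : isoAny M' = true) : False := by
  have hb : Function.Bijective (fun a : Fin 10 => ψ a) := by
    constructor
    · intro a b hab
      exact Fin.ext (hinj a a.2 b b.2 hab)
    · intro x
      obtain ⟨a, ha, hx⟩ := hsurj x
      exact ⟨⟨a, ha⟩, hx⟩
  have key : ∀ (L : List (ℕ × ℕ)) (E : SimpleGraph (Fin 10)),
      (∀ a b, E.Adj a b ↔ ladj L a b = true) → ∀ p ∈ perms1 ++ perms2, isoChk L M' p = true →
      Nonempty (G ≃g E) := by
    intro L E hE p hp hc
    obtain ⟨h1, h2⟩ := perms_ok p hp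
    refine iso_of (fun a : Fin 10 => ψ a) hb (fun a => ⟨p.getD a 0, h1 a a.2⟩) ?_ ?_
    · intro a b hab
      exact Fin.ext (h2 a a.2 b b.2 (by simpa using hab))
    · intro a b
      rw [hE, hadj a a.2 b b.2]
      simp only [isoChk, List.all_eq_true, List.mem_range, beq_iff_eq] at hc
      rw [hc a a.2 b b.2]
  simp only [isoAny, Bool.or_eq_true, List.any_eq_true] at h
  rcases h with ⟨p, hp, h⟩ | ⟨p, hp, h⟩
  · exact hG.2.2.1.false (key L1 E1 E1_adj p (List.mem_append_left _ hp) h).some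
  · exact hG.2.2.2.1.false (key L2 E2 E2_adj p (List.mem_append_right _ hp) h).some

lemma nshort_of {V : Type} [Fintype V] {G : SimpleGraph V} (hG : SmallestCex G) {n : ℕ}
    {M : ℕ → ℕ → Bool} {φ : ℕ → V} (h : Emb G n M φ) : nshort n M = true := by
  simp only [nshort, List.all_eq_true, List.mem_range, Bool.or_eq_true, Bool.not_eq_true',
    Bool.and_eq_true, Nat.beq_eq]
  intro a ha b hb
  by_cases h1 : M a b = false
  · exact Or.inl h1
  right
  intro c hc
  by_cases h2 : M b c = false
  · exact Or.inl (Or.inl h2)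
  by_cases hac : a = c
  · exact Or.inl (Or.inr hac)
  right
  have e1 := h.adj a ha b hb (by simpa using h1)
  have e2 := h.adj b hb c hc (by simpa using h2)
  constructor
  · by_contra h3
    exact noTri hG e1 e2 (h.adj c hc a ha (by simpa using h3))
  · intro d hd
    by_cases h3 : M c d = false
    · exact Or.inl (Or.inl h3)
    by_cases h4 : M d a = false
    · exact Or.inl (Or.inr h4)
    right
    by_contra hbd
    exact noSq hG e1 e2 (h.adj c hc d hd (by simpa using h3)) (h.adj d hd a ha (by simpa using h4))
      (fun e => hac (h.inj a ha c hc e)) (fun e => hbd (h.inj b hb d hd e))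

lemma colour_of {V : Type} {G : SimpleGraph V} {n : ℕ}
    {M : ℕ → ℕ → Bool} {φ : ℕ → V} (h : Emb G n M φ) (he : Exact G n M φ) {l : ℕ}
    (hl : cvalid n M l = true) : ∃ f, ColOn G (im n φ) f ∧ ∀ a < n, f (φ a) = cl l a := by
  refine h.col he _ ?_
  intro a ha b hb hab
  simp only [cvalid, List.all_eq_true, List.mem_range, Bool.or_eq_true, Bool.not_eq_true'] at hl
  rcases hl a ha b hb with h1 | h1
  · rw [hab] at h1; cases h1
  · exact (a5b_iff _ _).1 h1

lemma ladj_iff (L : List (ℕ × ℕ)) (a b : ℕ) :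
    ladj L a b = true ↔ (a, b) ∈ L ∨ (b, a) ∈ L := by
  simp only [ladj, List.any_eq_true, Bool.or_eq_true, Bool.and_eq_true, Nat.beq_eq]
  constructor
  · rintro ⟨⟨x, y⟩, h, ⟨h1, h2⟩ | ⟨h1, h2⟩⟩
    · left; simp only at h1 h2; subst h1 h2; exact h
    · right; simp only at h1 h2; subst h1 h2; exact h
  · rintro (h | h)
    · exact ⟨_, h, Or.inl ⟨rfl, rfl⟩⟩
    · exact ⟨_, h, Or.inr ⟨rfl, rfl⟩⟩

lemma case8 {V : Type} [Fintype V] {G : SimpleGraph V} (hG : SmallestCex G)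
    {M : ℕ → ℕ → Bool} {φ : ℕ → V} (h : Emb G 8 M φ) (he : Exact G 8 M φ) (Ls : List ℕ)
    (hne : Ls ≠ []) (hL : ∀ l ∈ Ls, cvalid 8 M l = true) (hc : chk8 M Ls = true)
    (hu : im 8 φ ≠ Finset.univ) (hP : PP G (im 8 φ) = 4) : False := by
  have hS : (im 8 φ).Nonempty := ⟨φ 0, mem_im.2 ⟨0, by omega, rfl⟩⟩
  have hcard := h.card
  obtain ⟨l0, hl0⟩ := List.exists_mem_of_ne_nil _ hne
  obtain ⟨f, hf, -⟩ := colour_of h he (hL l0 hl0)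
  have hi : ∀ f : V → Fin 5, ((im 8 φ).image f).card < (im 8 φ).card := img_lt (by omega)
  have hc2 : (im 8 φ)ᶜ.card = 2 := by
    obtain ⟨K, -, h⟩ := struct0 hG hS hu hf (hi f) (by omega)
    omega
  obtain ⟨y1, y2, u, v, hy, hm, hyy, hu', hv', hA1, hA2⟩ := alpha2 hG hS hu hf (hi f) (by omega) hc2
  obtain ⟨a, ha, rfl⟩ := mem_im.1 hu'
  obtain ⟨b, hb, rfl⟩ := mem_im.1 hv'
  have e1 := (hA1 _ hu').2 rfl
  have e2 := (hA2 _ hv').2 rfl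
  have hy1 := (hm y1).2 (Or.inl rfl)
  have hy2 := (hm y2).2 (Or.inr rfl)
  simp only [chk8, List.all_eq_true, List.mem_range, Bool.or_eq_true, Nat.beq_eq] at hc
  rcases hc a ha b hb with (hab | hs) | hiso
  · subst hab
    exact noTri hG hyy e2 e1.symm
  · simp only [sepB, List.any_eq_true, Bool.not_eq_true', beq_eq_false_iff_ne] at hs
    obtain ⟨l, hl, hne⟩ := hs
    obtain ⟨g, hg, hgv⟩ := colour_of h he (hL l hl)
    have := A_const hG hS hu hg (hi g) (by omega) (Or.inl hc2) ⟨hu', y1, hy1, e1⟩ ⟨hv', y2, hy2, e2⟩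
    rw [hgv a ha, hgv b hb] at this
    exact hne this
  · have hφm : ∀ c < 8, φ c ∈ im 8 φ := fun c hc => mem_im.2 ⟨c, hc, rfl⟩
    let ψ : ℕ → V := fun c => if c < 8 then φ c else if c = 8 then y1 else y2
    have ψ0 : ∀ c < 8, ψ c = φ c := fun c hc => if_pos hc
    have ψ8 : ψ 8 = y1 := rfl
    have ψ9 : ψ 9 = y2 := rfl
    have n1 : ∀ c < 8, φ c ≠ y1 := fun c hc e => hy1 (e ▸ hφm c hc)
    have n2 : ∀ c < 8, φ c ≠ y2 := fun c hc e => hy2 (e ▸ hφm c hc)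
    have split : ∀ c < 10, c < 8 ∨ c = 8 ∨ c = 9 := by omega
    refine iso_false hG ψ _ ?_ ?_ ?_ hiso
    · intro c hc d hd hcd
      rcases split c hc with hc | rfl | rfl <;> rcases split d hd with hd | rfl | rfl
      · rw [ψ0 c hc, ψ0 d hd] at hcd; exact h.inj c hc d hd hcd
      · rw [ψ0 c hc, ψ8] at hcd; exact (n1 c hc hcd).elim
      · rw [ψ0 c hc, ψ9] at hcd; exact (n2 c hc hcd).elim
      · rw [ψ0 d hd, ψ8] at hcd; exact (n1 d hd hcd.symm).elim
      · rfl
      · exact (hy hcd).elim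
      · rw [ψ0 d hd, ψ9] at hcd; exact (n2 d hd hcd.symm).elim
      · exact (hy hcd.symm).elim
      · rfl
    · intro x
      by_cases hx : x ∈ im 8 φ
      · obtain ⟨c, hc, rfl⟩ := mem_im.1 hx
        exact ⟨c, by omega, ψ0 c hc⟩
      · rcases (hm x).1 hx with rfl | rfl
        · exact ⟨8, by omega, rfl⟩
        · exact ⟨9, by omega, rfl⟩
    · have k1 : ∀ c < 8, G.Adj y1 (φ c) ↔ c = a := fun c hc => by
        rw [hA1 _ (hφm c hc)]; exact ⟨fun e => h.inj c hc a ha e, fun e => e ▸ rfl⟩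
      have k2 : ∀ c < 8, G.Adj y2 (φ c) ↔ c = b := fun c hc => by
        rw [hA2 _ (hφm c hc)]; exact ⟨fun e => h.inj c hc b hb e, fun e => e ▸ rfl⟩
      intro c hc d hd
      simp only [mext, Bool.or_eq_true, Bool.and_eq_true, Nat.blt_eq, ladj_iff, List.mem_cons,
        Prod.mk.injEq, List.not_mem_nil, or_false]
      rcases split c hc with hc | rfl | rfl <;> rcases split d hd with hd | rfl | rfl
      · rw [ψ0 c hc, ψ0 d hd]
        constructor
        · intro e; exact Or.inl ⟨⟨hc, hd⟩, he c hc d hd e⟩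
        · rintro (⟨_, e⟩ | e)
          · exact h.adj c hc d hd e
          · omega
      · rw [ψ0 c hc, ψ8, G.adj_comm, k1 c hc]; omega
      · rw [ψ0 c hc, ψ9, G.adj_comm, k2 c hc]; omega
      · rw [ψ0 d hd, ψ8, k1 d hd]; omega
      · rw [ψ8]; simp; omega
      · rw [ψ8, ψ9]; simp [hyy]
      · rw [ψ0 d hd, ψ9, k2 d hd]; omega
      · rw [ψ8, ψ9]; simp [hyy.symm]
      · rw [ψ9]; simp; omega

lemma case9 {V : Type} [Fintype V] {G : SimpleGraph V} (hG : SmallestCex G)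
    {M : ℕ → ℕ → Bool} {φ : ℕ → V} (h : Emb G 9 M φ) (he : Exact G 9 M φ) (Ls : List ℕ)
    (hne : Ls ≠ []) (hL : ∀ l ∈ Ls, cvalid 9 M l = true) (hc : chk9 M Ls = true)
    (hu : im 9 φ ≠ Finset.univ) (hP : PP G (im 9 φ) = 5) : False := by
  have hS : (im 9 φ).Nonempty := ⟨φ 0, mem_im.2 ⟨0, by omega, rfl⟩⟩
  have hcard := h.card
  have hi : ∀ f : V → Fin 5, ((im 9 φ).image f).card < (im 9 φ).card := img_lt (by omega)
  simp only [chk9, List.all_eq_true, List.mem_range, Bool.or_eq_true, Nat.beq_eq, Bool.and_eq_true,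
    Bool.not_eq_true'] at hc
  obtain ⟨hc1, hc2⟩ := hc
  have hφm : ∀ c < 9, φ c ∈ im 9 φ := fun c hc => mem_im.2 ⟨c, hc, rfl⟩
  have hcases : ((im 9 φ)ᶜ.card = 2 ∨ (im 9 φ)ᶜ.card = 9) ∨ (im 9 φ)ᶜ.card = 1 ∨ (im 9 φ)ᶜ.card = 5 := by
    obtain ⟨l0, hl0⟩ := List.exists_mem_of_ne_nil _ hne
    obtain ⟨f, hf, -⟩ := colour_of h he (hL l0 hl0)
    obtain ⟨K, -, h⟩ := struct0 hG hS hu hf (hi f) (by omega)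
    omega
  rcases hcases with hcc | hcc | hcc
  · refine lemR1 hG.1 (S := im 9 φ) (by omega) hu ?_
    intro s t hs ht
    obtain ⟨a, ha, rfl⟩ := mem_im.1 hs.1
    obtain ⟨b, hb, rfl⟩ := mem_im.1 ht.1
    rcases hc1 a ha b hb with rfl | ⟨hsep, -⟩
    · rfl
    · simp only [sepB, List.any_eq_true, Bool.not_eq_true', beq_eq_false_iff_ne] at hsep
      obtain ⟨l, hl, hne⟩ := hsep
      obtain ⟨g, hg, hgv⟩ := colour_of h he (hL l hl)
      have := A_const hG hS hu hg (hi g) (by omega) hcc hs ht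
      rw [hgv a ha, hgv b hb] at this
      exact (hne this).elim
  · obtain ⟨w, u, v, huv, hm, hu', hv', hA, hcol⟩ := beta hG hS hu (by omega) (by omega) hcc
    obtain ⟨a, ha, rfl⟩ := mem_im.1 hu'
    obtain ⟨b, hb, rfl⟩ := mem_im.1 hv'
    have e1 := (hA _ hu').2 (Or.inl rfl)
    have e2 := (hA _ hv').2 (Or.inr rfl)
    have hw := (hm w).2 rfl
    rcases hc1 a ha b hb with rfl | ⟨-, (hn | hM) | hiso⟩
    · exact huv rfl
    · simp only [nadB, List.any_eq_true, Bool.not_eq_true'] at hn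
      obtain ⟨l, hl, hne⟩ := hn
      obtain ⟨g, hg, hgv⟩ := colour_of h he (hL l hl)
      have := hcol g hg
      rw [hgv a ha, hgv b hb, ← a5b_iff, hne] at this
      cases this
    · exact noTri hG e1 (h.adj a ha b hb hM) e2.symm
    · let ψ : ℕ → V := fun c => if c < 9 then φ c else w
      have ψ0 : ∀ c < 9, ψ c = φ c := fun c hc => if_pos hc
      have ψ9 : ψ 9 = w := rfl
      have n1 : ∀ c < 9, φ c ≠ w := fun c hc e => hw (e ▸ hφm c hc)
      have split : ∀ c < 10, c < 9 ∨ c = 9 := by omega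
      refine iso_false hG ψ _ ?_ ?_ ?_ hiso
      · intro c hc d hd hcd
        rcases split c hc with hc | rfl <;> rcases split d hd with hd | rfl
        · rw [ψ0 c hc, ψ0 d hd] at hcd; exact h.inj c hc d hd hcd
        · rw [ψ0 c hc, ψ9] at hcd; exact (n1 c hc hcd).elim
        · rw [ψ0 d hd, ψ9] at hcd; exact (n1 d hd hcd.symm).elim
        · rfl
      · intro x
        by_cases hx : x ∈ im 9 φ
        · obtain ⟨c, hc, rfl⟩ := mem_im.1 hx
          exact ⟨c, by omega, ψ0 c hc⟩
        · exact ⟨9, by omega, ((hm x).1 hx).symm⟩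
      · have k1 : ∀ c < 9, G.Adj w (φ c) ↔ c = a ∨ c = b := fun c hc => by
          rw [hA _ (hφm c hc)]
          constructor
          · rintro (e | e)
            · exact Or.inl (h.inj c hc a ha e)
            · exact Or.inr (h.inj c hc b hb e)
          · rintro (rfl | rfl) <;> simp
        intro c hc d hd
        simp only [mext, Bool.or_eq_true, Bool.and_eq_true, Nat.blt_eq, ladj_iff, List.mem_cons,
          Prod.mk.injEq, List.not_mem_nil, or_false]
        rcases split c hc with hc | rfl <;> rcases split d hd with hd | rfl
        · rw [ψ0 c hc, ψ0 d hd]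
          constructor
          · intro e; exact Or.inl ⟨⟨hc, hd⟩, he c hc d hd e⟩
          · rintro (⟨_, e⟩ | e)
            · exact h.adj c hc d hd e
            · omega
        · rw [ψ0 c hc, ψ9, G.adj_comm, k1 c hc]; omega
        · rw [ψ0 d hd, ψ9, k1 d hd]; omega
        · rw [ψ9]; simp; omega
  · obtain ⟨s, hs, hA, d0, d1, d2, hd0, hd1, hd2, hcol⟩ := gamma hG hS hu (by omega) (by omega) hcc
    obtain ⟨a0, ha0, hs0⟩ := mem_im.1 (hs 0)
    obtain ⟨a1, ha1, hs1⟩ := mem_im.1 (hs 1)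
    obtain ⟨a2, ha2, hs2⟩ := mem_im.1 (hs 2)
    have hrig : ∀ a < 9, ∀ b < 9, ∀ d : Fin 5, d ≠ 0 →
        (∀ f, ColOn G (im 9 φ) f → cd (f (φ a)) (f (φ b)) = d) → rig Ls a b = true := by
      intro a ha b hb d hd hf
      have hl : ∀ l ∈ Ls, cd (cl l a) (cl l b) = d := by
        intro l hl
        obtain ⟨g, hg, hgv⟩ := colour_of h he (hL l hl)
        rw [← hgv a ha, ← hgv b hb]; exact hf g hg
      simp only [rig, Bool.and_eq_true, Bool.not_eq_true', List.all_eq_true, Nat.beq_eq]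
      constructor
      · by_contra hab
        have hab : a = b := by simpa using hab
        subst hab
        obtain ⟨l0, hl0⟩ := List.exists_mem_of_ne_nil _ hne
        apply hd
        rw [← hl l0 hl0]; simp [cd]
      · intro l hl'
        cases Ls with
        | nil => exact (hne rfl).elim
        | cons l0 t =>
          rw [hl l (List.mem_cons_of_mem _ hl')]
          simp only [List.headD_cons]
          rw [hl l0 (List.mem_cons_self ..)]
    have r01 := hrig a0 ha0 a1 ha1 d0 hd0 (fun f hf => by rw [hs0, hs1]; exact (hcol f hf).1)
    have r02 := hrig a0 ha0 a2 ha2 d1 hd1 (fun f hf => by rw [hs0, hs2]; exact (hcol f hf).2.1)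
    have r12 := hrig a1 ha1 a2 ha2 d2 hd2 (fun f hf => by rw [hs1, hs2]; exact (hcol f hf).2.2)
    have h5 : inC5 9 M a0 a1 a2 = true := by
      rcases hc2 a0 ha0 a1 ha1 with h1 | h1
      · rw [r01] at h1; cases h1
      · rcases h1 a2 ha2 with h2 | h2
        · rw [r02, r12] at h2; cases h2
        · exact h2
    simp only [inC5, List.any_eq_true, Bool.and_eq_true, List.mem_range, List.elem_eq_mem,
      decide_eq_true_eq] at h5
    obtain ⟨p1, l1, m01, p2, l2, m12, p3, l3, m23, p4, l4, ⟨m34, m40⟩, q1, q2⟩ := h5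
    refine lemR5 hG.1 (S := im 9 φ) (by omega) hu (φ a0) (φ p1) (φ p2) (φ p3) (φ p4)
      (hφm _ ha0) (hφm _ l1) (hφm _ l2) (hφm _ l3) (hφm _ l4) (h.adj _ ha0 _ l1 m01)
      (h.adj _ l1 _ l2 m12) (h.adj _ l2 _ l3 m23) (h.adj _ l3 _ l4 m34) (h.adj _ l4 _ ha0 m40) ?_
    have tr : ∀ x, x ∈ [p1, p2, p3, p4] →
        φ x = φ a0 ∨ φ x = φ p1 ∨ φ x = φ p2 ∨ φ x = φ p3 ∨ φ x = φ p4 := by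
      intro x hx
      simp only [List.mem_cons, List.not_mem_nil, or_false] at hx
      rcases hx with rfl | rfl | rfl | rfl <;> simp
    intro t ht
    obtain ⟨k, rfl⟩ := hA t ht
    have hk : k = 0 ∨ k = 1 ∨ k = 2 := by clear ht; revert k; decide
    rcases hk with rfl | rfl | rfl
    · rw [← hs0]; exact Or.inl rfl
    · rw [← hs1]; exact tr _ q1
    · rw [← hs2]; exact tr _ q2

lemma model_false {V : Type} [Fintype V] {G : SimpleGraph V} (hG : SmallestCex G) {k r j : ℕ}
    {φ : ℕ → V} (h : Emb G (k + r) (madj k r j) φ) (hk : 5 ≤ k) (hkr : k + r ≤ 9) (hj : j < k)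
    (hg : good k r j = true) : False := by
  have hns := nshort_of hG h
  have hcnt := cnt_all k (by omega) r (by omega) j hj hg hns
  have hchk := chk_all k (by omega) r (by omega) j hj hg hns
  generalize madj k r j = M at *
  generalize cols k r j = Ls at *
  generalize hn : k + r = n at *
  obtain ⟨l, hee, hex⟩ := h.ee
  have hcard := h.card
  have hP : PP G (im n φ) = n - 4 - 2 * l := by
    unfold PP; rw [hee, hcard, hcnt]; push_cast; ring
  have hS : (im n φ).Nonempty := ⟨φ 0, mem_im.2 ⟨0, by omega, rfl⟩⟩
  simp only [chk, Bool.and_eq_true, Bool.not_eq_true', List.all_eq_true] at hchk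
  obtain ⟨⟨hne, hL⟩, hchk⟩ := hchk
  have hne : Ls ≠ [] := by
    rintro rfl; simp at hne
  by_cases hu : im n φ = Finset.univ
  · have h2 := hG.2.2.2.2.1
    rw [pot_eq, ← hu, hP] at h2
    have hd := dart_eq G
    have h3 : ee G Finset.univ Finset.univ = dart G := by
      unfold ee dart; rw [Finset.univ_product_univ]
    rw [← hu, hee, hcnt] at h3
    have he := hex (by omega)
    obtain ⟨l0, hl0⟩ := List.exists_mem_of_ne_nil _ hne
    obtain ⟨f, hf, -⟩ := colour_of h he (hL l0 hl0)
    rw [hu] at hf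
    exact not_col hG.1 f (fun a b hab => hf a (by simp) b (by simp) hab)
  · have hLB := LB' hG hS hu
    have he := hex (by omega)
    have hl0 : l = 0 := by omega
    subst hl0
    rcases (by omega : n = 8 ∨ n = 9) with rfl | rfl
    · exact case8 hG h he Ls hne hL (by simpa using hchk) hu (by rw [hP]; norm_num)
    · exact case9 hG h he Ls hne hL (by simpa using hchk) hu (by rw [hP]; norm_num)

end

section
open Classical

lemma mem_edges_getVert {V : Type} {G : SimpleGraph V} {u v : V} (w : G.Walk u v) (e : Sym2 V) :
    e ∈ w.edges ↔ ∃ i < w.length, e = s(w.getVert i, w.getVert (i + 1)) := by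
  induction w with
  | nil => simp
  | cons h p ih =>
    simp only [Walk.edges_cons, List.mem_cons, ih, Walk.length_cons]
    constructor
    · rintro (rfl | ⟨i, hi, rfl⟩)
      · exact ⟨0, by omega, by simp⟩
      · exact ⟨i + 1, by omega, by simp [Walk.getVert_cons_succ]⟩
    · rintro ⟨i, hi, rfl⟩
      cases i with
      | zero => left; simp
      | succ i => right; exact ⟨i, by omega, by simp [Walk.getVert_cons_succ]⟩

/-- `p` runs around the cycle with support `S` and edges `E`. -/
structure Cyc {V : Type} (G : SimpleGraph V) (k : ℕ) (S : List V) (E : List (Sym2 V)) (x : V)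
    (p : ℕ → V) : Prop where
  three : 3 ≤ k
  zero : p 0 = x
  last : p k = x
  inj : ∀ a < k, ∀ b < k, p a = p b → a = b
  adj : ∀ a < k, G.Adj (p a) (p (a + 1))
  supp : ∀ v, v ∈ S ↔ ∃ a < k, p a = v
  edge : ∀ e, e ∈ E ↔ ∃ a < k, e = s(p a, p (a + 1))

lemma exists_cyc {V : Type} {G : SimpleGraph V} {u : V} {c : G.Walk u u} (hc : c.IsCycle) {x : V}
    (hx : x ∈ c.support) : ∃ p, Cyc G c.length c.support c.edges x p := by
  have hc' := hc.rotate hx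
  have hl : (c.rotate x hx).length = c.length := Walk.length_rotate _ _ _
  have hlast : (c.rotate x hx).getVert c.length = x := by
    have := (c.rotate x hx).getVert_length
    rwa [hl] at this
  refine ⟨(c.rotate x hx).getVert, hc.three_le_length, by simp, ?_, ?_, ?_, ?_, ?_⟩
  · exact hlast
  · intro a ha b hb hab
    refine hc'.getVert_injOn' ?_ ?_ hab
    · simp only [Set.mem_ofPred_eq]; omega
    · simp only [Set.mem_ofPred_eq]; omega
  · intro a ha
    exact Walk.adj_getVert_succ _ (by omega)
  · intro v
    rw [← Walk.mem_support_rotate_iff c x hx, Walk.mem_support_iff_exists_getVert]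
    constructor
    · rintro ⟨n, hn, hle⟩
      rcases Nat.lt_or_ge n c.length with h | h
      · exact ⟨n, h, hn⟩
      · refine ⟨0, by have := hc.three_le_length; omega, ?_⟩
        have : n = c.length := by omega
        rw [← hn, this, hlast]; simp
    · rintro ⟨a, ha, rfl⟩
      exact ⟨a, rfl, by omega⟩
  · intro e
    rw [← (Walk.rotate_edges c x hx).mem_iff, mem_edges_getVert, hl]

lemma Cyc.five {V : Type} [Fintype V] {G : SimpleGraph V} (hG : SmallestCex G) {k : ℕ} {S : List V}
    {E : List (Sym2 V)} {x : V} {p : ℕ → V} (h : Cyc G k S E x p) : 5 ≤ k := by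
  by_contra hk
  have h3 := h.three
  have e0 := h.adj 0 (by omega)
  have e1 := h.adj 1 (by omega)
  have e2 := h.adj 2 (by omega)
  have hl : p k = p 0 := h.last.trans h.zero.symm
  rcases (by omega : k = 3 ∨ k = 4) with rfl | rfl
  · rw [hl] at e2
    exact noTri hG e0 e1 e2
  · have e3 := h.adj 3 (by omega)
    rw [hl] at e3
    refine noSq hG e0 e1 e2 e3 (fun e => ?_) (fun e => ?_)
    · have := h.inj _ (by omega) _ (by omega) e; omega
    · have := h.inj _ (by omega) _ (by omega) e; omega

lemma share_false {V : Type} [Fintype V] {G : SimpleGraph V} (hG : SmallestCex G) {u1 u2 : V}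
    {c1 : G.Walk u1 u1} {c2 : G.Walk u2 u2} (hc1 : c1.IsCycle) (hc2 : c2.IsCycle) {x0 : V}
    (hx1 : x0 ∈ c1.support) (hx2 : x0 ∈ c2.support) {e : Sym2 V} (he2 : e ∈ c2.edges)
    (he1 : e ∉ c1.edges) (U : Finset V) (hU1 : ∀ v ∈ c1.support, v ∈ U)
    (hU2 : ∀ v ∈ c2.support, v ∈ U) (hU : U.card ≤ 9) : False := by
  obtain ⟨q, hq⟩ := exists_cyc hc2 hx2
  have hn5 := hq.five hG
  generalize hn : c2.length = n at *
  have hex : ∃ i, i < n ∧ s(q i, q (i + 1)) ∉ c1.edges := by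
    obtain ⟨i, hi, rfl⟩ := (hq.edge e).1 he2
    exact ⟨i, hi, he1⟩
  obtain ⟨i, ⟨hin, hie⟩, himin⟩ : ∃ i, (i < n ∧ s(q i, q (i + 1)) ∉ c1.edges) ∧
      ∀ i' < i, ¬ (i' < n ∧ s(q i', q (i' + 1)) ∉ c1.edges) :=
    ⟨Nat.find hex, Nat.find_spec hex, fun i' h => Nat.find_min hex h⟩
  have hxi : q i ∈ c1.support := by
    cases i with
    | zero => rw [hq.zero]; exact hx1
    | succ i =>
      have := himin i (by omega)
      have h2 : s(q i, q (i + 1)) ∈ c1.edges := by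
        by_contra h3; exact this ⟨by omega, h3⟩
      exact Walk.snd_mem_support_of_mem_edges _ h2
  have hqn : q n = q 0 := hq.last.trans hq.zero.symm
  have hex2 : ∃ r, i + r + 1 ≤ n ∧ q (i + r + 1) ∈ c1.support := by
    refine ⟨n - i - 1, by omega, ?_⟩
    rw [show i + (n - i - 1) + 1 = n by omega, hqn, hq.zero]; exact hx1
  obtain ⟨r, ⟨hrn, hrs⟩, hrmin⟩ : ∃ r, (i + r + 1 ≤ n ∧ q (i + r + 1) ∈ c1.support) ∧
      ∀ r' < r, ¬ (i + r' + 1 ≤ n ∧ q (i + r' + 1) ∈ c1.support) :=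
    ⟨Nat.find hex2, Nat.find_spec hex2, fun i' h => Nat.find_min hex2 h⟩
  obtain ⟨p, hp⟩ := exists_cyc hc1 hxi
  have hk5 := hp.five hG
  generalize hk : c1.length = k at *
  obtain ⟨j, hj, hpj⟩ := (hp.supp _).1 hrs
  have hpk : p k = p 0 := hp.last.trans hp.zero.symm
  let φ : ℕ → V := fun t => if t < k then p t else q (i + (t - k) + 1)
  have φ0 : ∀ t < k, φ t = p t := fun t ht => if_pos ht
  have φ1 : ∀ t, φ (k + t) = q (i + t + 1) := fun t => by
    simp only [φ]; rw [if_neg (by omega), show k + t - k = t by omega]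
  have hnot : ∀ t < r, q (i + t + 1) ∉ c1.support := fun t ht hm => hrmin t ht ⟨by omega, hm⟩
  have split : ∀ a < k + r, a < k ∨ ∃ t < r, a = k + t := by
    intro a ha
    rcases Nat.lt_or_ge a k with h | h
    · exact Or.inl h
    · exact Or.inr ⟨a - k, by omega, by omega⟩
  have hps : ∀ a < k, p a ∈ c1.support := fun a ha => (hp.supp _).2 ⟨a, ha, rfl⟩
  have hinj : ∀ a < k + r, ∀ b < k + r, φ a = φ b → a = b := by
    intro a ha b hb hab
    rcases split a ha with h1 | ⟨t, ht, rfl⟩ <;> rcases split b hb with h2 | ⟨t', ht', rfl⟩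
    · rw [φ0 a h1, φ0 b h2] at hab; exact hp.inj a h1 b h2 hab
    · rw [φ0 a h1, φ1] at hab
      exact (hnot t' ht' (hab ▸ hps a h1)).elim
    · rw [φ0 b h2, φ1] at hab
      exact (hnot t ht (hab ▸ hps b h2)).elim
    · rw [φ1, φ1] at hab
      have := hq.inj _ (by omega) _ (by omega) hab
      omega
  have hmed : ∀ a < k + r, ∀ b < k + r, medge k r j a b = true → G.Adj (φ a) (φ b) := by
    intro a ha b hb hab
    simp only [medge, Bool.or_eq_true, Bool.and_eq_true, Nat.beq_eq, Nat.blt_eq] at hab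
    rcases hab with (⟨rfl, h2⟩ | ⟨rfl, h2⟩) | hab
    · rw [φ0 a (by omega), φ0 _ h2]; exact hp.adj a (by omega)
    · rw [φ0 0 (by omega), φ0 b (by omega), ← hpk, ← h2]; exact (hp.adj b (by omega)).symm
    · have ha0 := hq.adj i hin
      cases r with
      | zero =>
        simp only [Bool.and_eq_true, Nat.beq_eq] at hab
        obtain ⟨rfl, rfl⟩ := hab
        rw [φ0 0 (by omega), φ0 _ hj, hp.zero, hpj]; exact ha0
      | succ r =>
        simp only [Bool.or_eq_true, Bool.and_eq_true, Nat.beq_eq, Nat.blt_eq, Nat.ble_eq] at hab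
        rcases hab with (⟨rfl, h2⟩ | ⟨⟨h1, rfl⟩, h3⟩) | ⟨rfl, h2⟩
        · have := φ1 0
          simp only [add_zero] at this
          rw [h2, this, φ0 0 (by omega), hp.zero]; exact ha0
        · obtain ⟨t, rfl⟩ := Nat.exists_eq_add_of_le h1
          rw [φ1, add_assoc k t 1, φ1]
          exact hq.adj (i + t + 1) (by omega)
        · rw [φ0 _ hj, hpj, show b = k + r by omega, φ1]
          exact (hq.adj (i + r + 1) (by omega)).symm
  have hE : Emb G (k + r) (madj k r j) φ := by
    refine ⟨hinj, ?_⟩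
    intro a ha b hb hab
    simp only [madj, Bool.or_eq_true] at hab
    rcases hab with h | h
    · exact hmed a ha b hb h
    · exact (hmed b hb a ha h).symm
  have hle : k + r ≤ 9 := by
    rw [← hE.card]
    refine le_trans (Finset.card_le_card ?_) hU
    intro v hv
    obtain ⟨a, ha, rfl⟩ := mem_im.1 hv
    rcases split a ha with h1 | ⟨t, ht, rfl⟩
    · rw [φ0 a h1]; exact hU1 _ (hps a h1)
    · rw [φ1]; exact hU2 _ ((hq.supp _).2 ⟨_, by omega, rfl⟩)
  refine model_false hG hE hk5 hle hj ?_
  simp only [good, Bool.and_eq_true, Nat.ble_eq, Nat.blt_eq]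
  refine ⟨⟨hk5, hj⟩, ?_⟩
  rcases (by omega : r = 0 ∨ r = 1 ∨ 2 ≤ r) with rfl | rfl | hr
  · have hj0 : j ≠ 0 := by
      rintro rfl
      rw [hp.zero] at hpj
      have := hq.adj i hin
      rw [add_zero] at hpj
      rw [← hpj] at this
      exact G.loopless.irrefl _ this
    have hj1 : j ≠ 1 := by
      rintro rfl
      apply hie
      rw [hp.edge]
      refine ⟨0, by omega, ?_⟩
      rw [hp.zero, zero_add, hpj]
    have hjk : j + 1 ≠ k := by
      intro hjk
      apply hie
      rw [hp.edge]
      refine ⟨j, by omega, ?_⟩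
      rw [hjk, hp.last, hpj, Sym2.eq_swap]
    simp [hj0, hj1, hjk]
  · have hj0 : j ≠ 0 := by
      rintro rfl
      rw [hp.zero] at hpj
      rcases Nat.lt_or_ge (i + 1 + 1) n with h | h
      · have := hq.inj _ hin _ h hpj; omega
      · rw [show i + 1 + 1 = n by omega, hqn] at hpj
        have := hq.inj _ hin _ (by omega) hpj; omega
    simp [hj0]
  · rw [if_neg (by simp; omega), if_neg (by simp; omega)]

lemma Cyc.card_le {V : Type} {G : SimpleGraph V} {k : ℕ} {S : List V}
    {E : List (Sym2 V)} {x : V} {p : ℕ → V} (h : Cyc G k S E x p) : S.toFinset.card = k := by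
  have : S.toFinset = (Finset.range k).image p := by
    ext v; simp [h.supp]
  rw [this, Finset.card_image_of_injOn, Finset.card_range]
  intro a ha b hb hab
  exact h.inj a (by simpa using ha) b (by simpa using hb) hab

lemma share_false' {V : Type} [Fintype V] {G : SimpleGraph V} (hG : SmallestCex G) {u1 u2 : V}
    {c1 : G.Walk u1 u1} {c2 : G.Walk u2 u2} (hc1 : c1.IsCycle) (hc2 : c2.IsCycle) {x0 : V}
    (hx1 : x0 ∈ c1.support) (hx2 : x0 ∈ c2.support)
    (hne : {e | e ∈ c1.edges} ≠ {e | e ∈ c2.edges}) (U : Finset V) (hU1 : ∀ v ∈ c1.support, v ∈ U)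
    (hU2 : ∀ v ∈ c2.support, v ∈ U) (hU : U.card ≤ 9) : False := by
  apply hne
  ext e
  simp only [Set.mem_ofPred_eq]
  constructor
  · intro h; by_contra h'
    exact share_false hG hc2 hc1 hx2 hx1 h h' U hU2 hU1 hU
  · intro h; by_contra h'
    exact share_false hG hc1 hc2 hx1 hx2 h h' U hU1 hU2 hU

lemma two_cycles {V : Type} [Fintype V] {G : SimpleGraph V} (hG : SmallestCex G) {u1 u2 : V}
    {c1 : G.Walk u1 u1} {c2 : G.Walk u2 u2} (hc1 : c1.IsCycle) (hc2 : c2.IsCycle)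
    (hne : {e | e ∈ c1.edges} ≠ {e | e ∈ c2.edges}) (U : Finset V) (hU1 : ∀ v ∈ c1.support, v ∈ U)
    (hU2 : ∀ v ∈ c2.support, v ∈ U) : 10 ≤ U.card := by
  by_cases hs : ∃ x, x ∈ c1.support ∧ x ∈ c2.support
  · obtain ⟨x, h1, h2⟩ := hs
    by_contra h
    exact share_false' hG hc1 hc2 h1 h2 hne U hU1 hU2 (by omega)
  · obtain ⟨p, hp⟩ := exists_cyc hc1 c1.start_mem_support
    obtain ⟨q, hq⟩ := exists_cyc hc2 c2.start_mem_support
    have hd : Disjoint c1.support.toFinset c2.support.toFinset := by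
      rw [Finset.disjoint_left]
      intro x h1 h2
      exact hs ⟨x, by simpa using h1, by simpa using h2⟩
    have hsub : c1.support.toFinset ∪ c2.support.toFinset ⊆ U := by
      intro x hx
      simp only [Finset.mem_union, List.mem_toFinset] at hx
      rcases hx with h | h
      · exact hU1 _ h
      · exact hU2 _ h
    have := Finset.card_le_card hsub
    rw [Finset.card_union_of_disjoint hd, hp.card_le, hq.card_le] at this
    have := hp.five hG
    have := hq.five hG
    omega

end

/-- Every subgraph of a smallest counterexample containing two distinct
cycles has at least 10 vertices; in particular, any two distinct 5-cycles in a smallest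
counterexample are vertex-disjoint. -/
theorem smallestCex_two_cycles_ten_vertices {V : Type} [Fintype V] (G : SimpleGraph V)
    (h : SmallestCex G) :
    (∀ H : G.Subgraph, TwoDistinctCycles H.coe → 10 ≤ H.verts.ncard) ∧
    (∀ (v1 v2 : V) (c1 : G.Walk v1 v1) (c2 : G.Walk v2 v2),
      c1.IsCycle → c2.IsCycle → c1.length = 5 → c2.length = 5 →
      {e | e ∈ c1.edges} ≠ {e | e ∈ c2.edges} →
      ∀ x, x ∈ c1.support → x ∉ c2.support) := by
  classical
  refine ⟨?_, ?_⟩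
  · rintro H ⟨v1, v2, c1, c2, hc1, hc2, hne⟩
    have hinj : Function.Injective H.hom := Subgraph.hom_injective
    have hmem : ∀ {v : H.verts} (c : H.coe.Walk v v), ∀ x ∈ (c.map H.hom).support,
        x ∈ H.verts.toFinset := by
      intro v c x hx
      rw [Walk.support_map, List.mem_map] at hx
      obtain ⟨y, -, rfl⟩ := hx
      rw [Set.mem_toFinset]
      exact y.2
    have hedge : ∀ {v : H.verts} (c : H.coe.Walk v v) (e : Sym2 H.verts),
        e ∈ c.edges ↔ Sym2.map H.hom e ∈ (c.map H.hom).edges := by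
      intro v c e
      rw [Walk.edges_map, List.mem_map_of_injective (Sym2.map.injective hinj)]
    have := two_cycles h (c1 := c1.map H.hom) (c2 := c2.map H.hom)
      (hc1.map hinj) (hc2.map hinj) ?_ H.verts.toFinset
      (hmem c1) (hmem c2)
    · rwa [Set.ncard_eq_toFinset_card']
    · intro he
      apply hne
      ext e
      have := Set.ext_iff.1 he (Sym2.map H.hom e)
      simp only [Set.mem_ofPred_eq] at this ⊢
      rw [hedge c1, hedge c2]
      exact this
  · intro v1 v2 c1 c2 hc1 hc2 hl1 hl2 hne x hx1 hx2
    obtain ⟨p, hp⟩ := exists_cyc hc1 hx1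
    obtain ⟨q, hq⟩ := exists_cyc hc2 hx2
    have hp' := hp.card_le
    have hq' := hq.card_le
    have := two_cycles h hc1 hc2 hne (c1.support.toFinset ∪ c2.support.toFinset)
      (fun v hv => by simp [hv]) (fun v hv => by simp [hv])
    have hi : 0 < (c1.support.toFinset ∩ c2.support.toFinset).card :=
      Finset.card_pos.2 ⟨x, by simp [hx1, hx2]⟩
    have hui := Finset.card_union_add_card_inter c1.support.toFinset c2.support.toFinset
    have e1 : c1.support.toFinset.card = 5 := by convert hp'.trans hl1
    have e2 : c2.support.toFinset.card = 5 := by convert hq'.trans hl2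
    omega
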